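/- Let d ≥ 1, 2 < p < ∞ and 1/p < r < 1/2. There is a constant C (depending only on d, p, r) such that for all m ≥ 2 the Kolmogorov numbers of the embedding of the Sobolev space of mixed smoothness into the uniform norm satisfy d_m(I : W^r_p(𝕋^d) → L_∞(𝕋^d)) ≤ C m^{−r} (log m)^{(d−1)(1−r) + r}. -/

import Mathlib

open MeasureTheory Real
open scoped ENNReal ComplexConjugate Classical

noncomputable section

instance : Fact (0 < 2 * π) := ⟨by positivity⟩

/-- The `d`-dimensional torus `[0, 2π]^d`. -/
abbrev Torus (d : ℕ) := Fin d → AddCircle (2 * π)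

/-- The multivariate trigonometric character `x ↦ e^{i k · x}`. -/
def trigChar {d : ℕ} (k : Fin d → ℤ) : C(Torus d, ℂ) :=
  ⟨fun x => ∏ j, fourier (k j) (x j),
    continuous_finset_prod _ fun j _ => (map_continuous (fourier (k j))).comp (continuous_apply j)⟩

/-- The Fourier coefficient `f̂(k) = (2π)^{-d} ∫ f(x) e^{-i k·x} dx`. -/
def fCoeff {d : ℕ} (f : Torus d → ℂ) (k : Fin d → ℤ) : ℂ :=
  ((2 * π) ^ d)⁻¹ • ∫ x : Torus d, conj (trigChar k x) * f x

/-- The Fourier coefficients `F̂_{r,0}(k) = ∏_j |k_j|^{-r}` (with the convention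
`|0|^{-r} = 1`) of the multivariate Bernoulli kernel `F_{r,α}` for `α = 0`. -/
def wBern (d : ℕ) (r : ℝ) (k : Fin d → ℤ) : ℝ :=
  ∏ j, if k j = 0 then 1 else |(k j : ℝ)| ^ (-r)

/-- `f = F_{r,0} ∗ φ`, expressed through Fourier coefficients:
`f̂(k) = F̂_{r,0}(k) φ̂(k)` for all `k ∈ ℤ^d`. -/
def WRel (d : ℕ) (r : ℝ) (q : ℝ≥0∞) (f : Lp ℂ ∞ (volume : Measure (Torus d)))
    (φ : Lp ℂ q (volume : Measure (Torus d))) : Prop :=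
  ∀ k : Fin d → ℤ,
    fCoeff (f : Torus d → ℂ) k = (wBern d r k : ℂ) * fCoeff (φ : Torus d → ℂ) k

/-- The Sobolev space `W^r_p(𝕋^d)` of mixed smoothness: all `f = F_{r,0} ∗ φ` with
`φ ∈ L_p(𝕋^d)`, realized (for `r > 1/p`, via the embedding into `L_∞`) as a subset of
`L_∞(𝕋^d)`; it is normed by `‖f‖ := ‖φ‖_p`. -/
def WSpace (d : ℕ) (r : ℝ) (q : ℝ≥0∞) : Type :=
  {f : Lp ℂ ∞ (volume : Measure (Torus d)) //
    ∃ φ : Lp ℂ q (volume : Measure (Torus d)), WRel d r q f φ}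

noncomputable instance (d : ℕ) (r : ℝ) (q : ℝ≥0∞) : Norm (WSpace d r q) :=
  ⟨fun f => sInf {c : ℝ | ∃ φ : Lp ℂ q (volume : Measure (Torus d)),
    WRel d r q f.1 φ ∧ ‖φ‖ = c}⟩

/-- Kolmogorov numbers. -/
noncomputable def dK {A B : Type*} [Norm A] [NormedAddCommGroup B] [NormedSpace ℂ B]
    (T : A → B) (m : ℕ) : ℝ :=
  ⨅ L : {L : Submodule ℂ B // FiniteDimensional ℂ L ∧ Module.finrank ℂ L < m},
    ⨆ a : {a : A // ‖a‖ ≤ 1}, ⨅ b : L.1, ‖T a.1 - (b : B)‖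

/-- The sign `±1` encoded by a Boolean. -/
def boolSign (b : Bool) : ℝ := if b then 1 else -1

theorem exp_norm_sq_add_sub_le (c : ℝ) (s a : ℂ) :
    Real.exp (c * ‖s + a‖ ^ 2) + Real.exp (c * ‖s - a‖ ^ 2) ≤
      2 * Real.exp (c * ‖a‖ ^ 2 + (c + 2 * c ^ 2 * ‖a‖ ^ 2) * ‖s‖ ^ 2) := by
  rw [norm_add_sq_real, norm_sub_sq_real]
  set q := inner ℝ s a with hq
  have hqb : q ^ 2 ≤ ‖s‖ ^ 2 * ‖a‖ ^ 2 := by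
    have := abs_real_inner_le_norm s a
    rw [← mul_pow, ← sq_abs]
    gcongr
  have h1 : Real.exp (c * (‖s‖ ^ 2 + 2 * q + ‖a‖ ^ 2)) + Real.exp (c * (‖s‖ ^ 2 - 2 * q + ‖a‖ ^ 2))
      = 2 * (Real.exp (c * (‖s‖ ^ 2 + ‖a‖ ^ 2)) * Real.cosh (2 * c * q)) := by
    rw [Real.cosh_eq]
    have e1 : c * (‖s‖ ^ 2 + 2 * q + ‖a‖ ^ 2) = c * (‖s‖ ^ 2 + ‖a‖ ^ 2) + 2 * c * q := by ring
    have e2 : c * (‖s‖ ^ 2 - 2 * q + ‖a‖ ^ 2) = c * (‖s‖ ^ 2 + ‖a‖ ^ 2) + -(2 * c * q) := by ring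
    rw [e1, e2, Real.exp_add, Real.exp_add]
    ring
  rw [h1]
  have h2 := Real.cosh_le_exp_half_sq (2 * c * q)
  have h3 : Real.exp (c * (‖s‖ ^ 2 + ‖a‖ ^ 2)) * Real.cosh (2 * c * q) ≤
      Real.exp (c * (‖s‖ ^ 2 + ‖a‖ ^ 2)) * Real.exp ((2 * c * q) ^ 2 / 2) := by gcongr
  rw [← Real.exp_add] at h3
  have h4 : c * (‖s‖ ^ 2 + ‖a‖ ^ 2) + (2 * c * q) ^ 2 / 2 ≤
      c * ‖a‖ ^ 2 + (c + 2 * c ^ 2 * ‖a‖ ^ 2) * ‖s‖ ^ 2 := by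
    nlinarith [mul_le_mul_of_nonneg_left hqb (sq_nonneg c)]
  have h5 := Real.exp_le_exp.mpr h4
  linarith

theorem sum_option_bool {α : Type*} [Fintype α] (h : (Option α → Bool) → ℝ) :
    ∑ ω, h ω = ∑ ω : α → Bool,
      (h (fun o => o.elim true ω) + h (fun o => o.elim false ω)) := by
  rw [← (Equiv.piOptionEquivProd (β := fun _ : Option α => Bool)).symm.sum_comp,
    Fintype.sum_prod_type, Finset.sum_comm]
  refine Finset.sum_congr rfl fun ω _ => ?_
  rw [Fintype.sum_bool]
  congr 2 <;> (funext o; cases o <;> rfl)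

theorem sum_exp_sign_step {α : Type} [Fintype α] (a : Option α → ℂ) (c : ℝ) :
    ∑ ω : Option α → Bool, Real.exp (c * ‖∑ i, (boolSign (ω i) : ℂ) * a i‖ ^ 2) ≤
      2 * Real.exp (c * ‖a none‖ ^ 2) * ∑ ω : α → Bool,
        Real.exp ((c + 2 * c ^ 2 * ‖a none‖ ^ 2) *
          ‖∑ i, (boolSign (ω i) : ℂ) * a (some i)‖ ^ 2) := by
  rw [sum_option_bool, Finset.mul_sum]
  refine Finset.sum_le_sum fun ω _ => ?_
  simp only [Fintype.sum_option, Option.elim]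
  have h := exp_norm_sq_add_sub_le c (∑ i, (boolSign (ω i) : ℂ) * a (some i)) (a none)
  rw [Real.exp_add, ← mul_assoc] at h
  refine le_trans (le_of_eq ?_) h
  simp only [boolSign]
  congr 4
  · push_cast; simp [add_comm]
  · simp [add_comm, sub_eq_add_neg]

theorem sum_exp_sign_le {ι : Type} [Fintype ι] (a : ι → ℂ) (c : ℝ) (hc : 0 ≤ c)
    (hS : 2 * c * ∑ i, ‖a i‖ ^ 2 < 1) :
    ∑ ω : ι → Bool, Real.exp (c * ‖∑ i, (boolSign (ω i) : ℂ) * a i‖ ^ 2) ≤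
      2 ^ Fintype.card ι *
        Real.exp (c * (∑ i, ‖a i‖ ^ 2) / (1 - 2 * c * ∑ i, ‖a i‖ ^ 2)) := by
  revert a c
  refine Fintype.induction_empty_option
    (P := fun ι [Fintype ι] => ∀ (a : ι → ℂ) (c : ℝ), 0 ≤ c → 2 * c * ∑ i, ‖a i‖ ^ 2 < 1 →
      ∑ ω : ι → Bool, Real.exp (c * ‖∑ i, (boolSign (ω i) : ℂ) * a i‖ ^ 2) ≤
      2 ^ Fintype.card ι *
        Real.exp (c * (∑ i, ‖a i‖ ^ 2) / (1 - 2 * c * ∑ i, ‖a i‖ ^ 2))) ?_ ?_ ?_ ι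
  · intro α β _ e H a c hc hS
    let _ := Fintype.ofEquiv β e.symm
    have := H (fun i => a (e i)) c hc (by rwa [e.sum_comp (fun i => ‖a i‖ ^ 2)])
    rw [e.sum_comp (fun i => ‖a i‖ ^ 2)] at this
    rw [← (Equiv.arrowCongr e (Equiv.refl Bool)).sum_comp]
    refine le_trans (le_of_eq ?_) (this.trans (le_of_eq ?_))
    · refine Finset.sum_congr rfl fun ω _ => ?_
      rw [← e.sum_comp]
      simp [Equiv.arrowCongr]
    · simp [Fintype.card_congr e]
  · intro a c hc hS
    simp
  · intro α _ H a c hc hS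
    refine le_trans (le_of_eq (by congr!)) ((sum_exp_sign_step a c).trans ?_)
    rw [Fintype.sum_option] at hS ⊢
    set A := ‖a none‖ ^ 2 with hA
    have hA0 : 0 ≤ A := by positivity
    set S := ∑ i, ‖a (some i)‖ ^ 2 with hSS
    have hS0 : 0 ≤ S := by positivity
    have hcS : 0 ≤ c * S := by positivity
    have hcA : 0 ≤ c * A := by positivity
    have h1 : 0 < 1 - 2 * c * A := by nlinarith
    have h2 : 0 < 1 - 2 * c * (A + S) := by nlinarith
    set c' := c / (1 - 2 * c * A) with hc'
    have hc'0 : 0 ≤ c' := by positivity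
    have hcc : c + 2 * c ^ 2 * A ≤ c' := by
      rw [hc', le_div_iff₀ h1]
      nlinarith [mul_nonneg hc (mul_nonneg hcA hcA)]
    have h3 : 2 * c' * S < 1 := by
      rw [hc', show 2 * (c / (1 - 2 * c * A)) * S = (2 * c * S) / (1 - 2 * c * A) by ring,
        div_lt_one h1]
      nlinarith
    have h4 := H (fun i => a (some i)) c' hc'0 h3
    have h5 : ∑ ω : α → Bool, Real.exp ((c + 2 * c ^ 2 * A) *
          ‖∑ i, (boolSign (ω i) : ℂ) * a (some i)‖ ^ 2) ≤
          ∑ ω : α → Bool, Real.exp (c' * ‖∑ i, (boolSign (ω i) : ℂ) * a (some i)‖ ^ 2) := by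
      gcongr
    have h6 := h5.trans h4
    rw [Fintype.card_option, pow_succ' (2 : ℝ)]
    have h7 : c' * S / (1 - 2 * c' * S) = c * S / (1 - 2 * c * (A + S)) := by
      have : 1 - 2 * c' * S = (1 - 2 * c * (A + S)) / (1 - 2 * c * A) := by
        rw [hc']; field_simp; ring
      rw [this, hc', div_mul_eq_mul_div, div_div_div_cancel_right₀ h1.ne']
    have h8 : c * A + c * S / (1 - 2 * c * (A + S)) ≤
        c * (A + S) / (1 - 2 * c * (A + S)) := by
      rw [mul_add c A S, add_div]
      gcongr
      rw [le_div_iff₀ h2]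
      nlinarith [mul_nonneg hcA hcA, mul_nonneg hcA hcS]
    calc _ ≤ 2 * Real.exp (c * A) * (2 ^ Fintype.card α *
          Real.exp (c' * S / (1 - 2 * c' * S))) := by gcongr
      _ = 2 * 2 ^ Fintype.card α * Real.exp (c * A + c * S / (1 - 2 * c * (A + S))) := by
          rw [h7, Real.exp_add]; ring
      _ ≤ _ := by gcongr

theorem sum_exp_neg_sign_le {ι : Type} [Fintype ι] (a : ι → ℂ) (c : ℝ) (hc : 0 ≤ c)
    (hS : 2 * c * ∑ i, ‖a i‖ ^ 2 ≤ 1) :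
    ∑ ω : ι → Bool, Real.exp (-c * ‖∑ i, (boolSign (ω i) : ℂ) * a i‖ ^ 2) ≤
      2 ^ Fintype.card ι *
        Real.exp (-c * (∑ i, ‖a i‖ ^ 2) + 2 * c ^ 2 * (∑ i, ‖a i‖ ^ 2) ^ 2) := by
  revert a c
  refine Fintype.induction_empty_option
    (P := fun ι [Fintype ι] => ∀ (a : ι → ℂ) (c : ℝ), 0 ≤ c → 2 * c * ∑ i, ‖a i‖ ^ 2 ≤ 1 →
      ∑ ω : ι → Bool, Real.exp (-c * ‖∑ i, (boolSign (ω i) : ℂ) * a i‖ ^ 2) ≤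
      2 ^ Fintype.card ι *
        Real.exp (-c * (∑ i, ‖a i‖ ^ 2) + 2 * c ^ 2 * (∑ i, ‖a i‖ ^ 2) ^ 2)) ?_ ?_ ?_ ι
  · intro α β _ e H a c hc hS
    let _ := Fintype.ofEquiv β e.symm
    have := H (fun i => a (e i)) c hc (by rwa [e.sum_comp (fun i => ‖a i‖ ^ 2)])
    rw [e.sum_comp (fun i => ‖a i‖ ^ 2)] at this
    rw [← (Equiv.arrowCongr e (Equiv.refl Bool)).sum_comp]
    refine le_trans (le_of_eq ?_) (this.trans (le_of_eq ?_))
    · refine Finset.sum_congr rfl fun ω _ => ?_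
      rw [← e.sum_comp]
      simp [Equiv.arrowCongr]
    · simp [Fintype.card_congr e]
  · intro a c hc hS
    simp
  · intro α _ H a c hc hS
    refine le_trans (le_of_eq (by congr!)) ((sum_exp_sign_step a (-c)).trans ?_)
    rw [Fintype.sum_option] at hS ⊢
    set A := ‖a none‖ ^ 2 with hA
    have hA0 : 0 ≤ A := by positivity
    set S := ∑ i, ‖a (some i)‖ ^ 2 with hSS
    have hS0 : 0 ≤ S := by positivity
    have hcS : 0 ≤ c * S := by positivity
    have hcA : 0 ≤ c * A := by positivity
    set c' := c - 2 * c ^ 2 * A with hc'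
    have hc'0 : 0 ≤ c' := by
      have : c' = c * (1 - 2 * (c * A)) := by rw [hc']; ring
      rw [this]
      exact mul_nonneg hc (by nlinarith)
    have hle : c' ≤ c := by
      rw [hc']; nlinarith [mul_nonneg hc hcA]
    have h3 : 2 * c' * S ≤ 1 := by nlinarith [mul_le_mul_of_nonneg_right hle hS0]
    have h4 := H (fun i => a (some i)) c' hc'0 h3
    rw [Fintype.card_option, pow_succ' (2 : ℝ)]
    have h8 : -c * A + (-c' * S + 2 * c' ^ 2 * S ^ 2) ≤
        -c * (A + S) + 2 * c ^ 2 * (A + S) ^ 2 := by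
      have : c' ^ 2 * S ^ 2 ≤ c ^ 2 * S ^ 2 := by gcongr
      have e : c' * S = c * S - 2 * c ^ 2 * A * S := by rw [hc']; ring
      nlinarith [mul_nonneg (mul_nonneg hcA hcS) hc, mul_nonneg hcA hcS, sq_nonneg (c * A)]
    have e1 : (-c + 2 * (-c) ^ 2 * A) = -c' := by rw [hc']; ring
    rw [e1]
    calc _ ≤ 2 * Real.exp (-c * A) * (2 ^ Fintype.card α *
          Real.exp (-c' * S + 2 * c' ^ 2 * S ^ 2)) := by gcongr
      _ = 2 * 2 ^ Fintype.card α *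
          Real.exp (-c * A + (-c' * S + 2 * c' ^ 2 * S ^ 2)) := by
          rw [Real.exp_add (-c * A)]; ring
      _ ≤ _ := by gcongr

/-- The squared norm of the image of `a` under a sign matrix. -/
def signForm {ι : Type} [Fintype ι] {m : ℕ} (G : Fin m → ι → Bool) (a : ι → ℂ) : ℝ :=
  ∑ l, ‖∑ i, (boolSign (G l i) : ℂ) * a i‖ ^ 2

theorem sum_exp_signForm {ι : Type} [Fintype ι] {m : ℕ} (a : ι → ℂ) (c : ℝ) :
    ∑ G : Fin m → ι → Bool, Real.exp (c * signForm G a) =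
      (∑ ω : ι → Bool, Real.exp (c * ‖∑ i, (boolSign (ω i) : ℂ) * a i‖ ^ 2)) ^ m := by
  simp only [signForm, Finset.mul_sum, Real.exp_sum]
  rw [Fintype.sum_pow]

/-- Upper tail: few sign matrices blow up the norm of a vector. -/
theorem card_signForm_large {ι : Type} [Fintype ι] {m : ℕ} (a : ι → ℂ) (R : ℝ)
    (hR : 0 < R) (ha : ∑ i, ‖a i‖ ^ 2 ≤ R) :
    ((Finset.univ.filter fun G : Fin m → ι → Bool => 6 * R * m ≤ signForm G a).card : ℝ) ≤
      (2 ^ Fintype.card ι) ^ m * Real.exp (-(m : ℝ)) := by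
  set S := ∑ i, ‖a i‖ ^ 2 with hS
  have hS0 : 0 ≤ S := by positivity
  have h1 : 2 * (1 / (4 * R)) * S < 1 := by
    rw [show 2 * (1 / (4 * R)) * S = S / (2 * R) by field_simp; ring, div_lt_one (by positivity)]
    linarith
  have h2 := sum_exp_sign_le a (1 / (4 * R)) (by positivity) h1
  have h3 : 1 / (4 * R) * S / (1 - 2 * (1 / (4 * R)) * S) ≤ 1 / 2 := by
    rw [div_le_iff₀ (by linarith)]
    have : 1 / (4 * R) * S ≤ 1 / 4 := by
      rw [one_div_mul_eq_div, div_le_iff₀ (by positivity)]; linarith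
    linarith
  have h4 : ∑ ω : ι → Bool, Real.exp (1 / (4 * R) * ‖∑ i, (boolSign (ω i) : ℂ) * a i‖ ^ 2) ≤
      2 ^ Fintype.card ι * Real.exp (1 / 2) := h2.trans (by gcongr)
  have h5 : ∑ G : Fin m → ι → Bool, Real.exp (1 / (4 * R) * signForm G a) ≤
      (2 ^ Fintype.card ι * Real.exp (1 / 2)) ^ m := by
    rw [sum_exp_signForm]
    gcongr
  have h6 : ((Finset.univ.filter fun G : Fin m → ι → Bool => 6 * R * m ≤ signForm G a).card : ℝ) *
      Real.exp (3 / 2 * m) ≤ ∑ G : Fin m → ι → Bool, Real.exp (1 / (4 * R) * signForm G a) := by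
    rw [← nsmul_eq_mul, ← Finset.sum_const]
    refine (Finset.sum_le_sum fun G hG => ?_).trans
      (Finset.sum_le_sum_of_subset_of_nonneg (Finset.filter_subset _ _) fun _ _ _ => by positivity)
    rw [Finset.mem_filter] at hG
    refine Real.exp_le_exp.mpr ?_
    rw [one_div_mul_eq_div, le_div_iff₀ (by positivity)]
    linarith [hG.2]
  have h7 := h6.trans h5
  rw [← le_div_iff₀ (by positivity)] at h7
  refine h7.trans (le_of_eq ?_)
  rw [mul_pow, mul_div_assoc, ← Real.exp_nat_mul, ← Real.exp_sub]
  congr 2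
  ring

/-- Lower tail: few sign matrices shrink the norm of a vector. -/
theorem card_signForm_small {ι : Type} [Fintype ι] {m : ℕ} (a : ι → ℂ) :
    ((Finset.univ.filter fun G : Fin m → ι → Bool =>
      signForm G a < (∑ i, ‖a i‖ ^ 2) * m / 4).card : ℝ) ≤
      (2 ^ Fintype.card ι) ^ m * Real.exp (-(m / 16 : ℝ)) := by
  set S := ∑ i, ‖a i‖ ^ 2 with hS
  have hS0 : 0 ≤ S := by positivity
  rcases hS0.eq_or_lt with h0 | h0
  · have : (Finset.univ.filter fun G : Fin m → ι → Bool => signForm G a < S * m / 4) = ∅ := by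
      rw [Finset.filter_eq_empty_iff]
      intro G _
      rw [← h0, not_lt]
      simp only [zero_mul, zero_div, signForm]
      positivity
    rw [this, Finset.card_empty, Nat.cast_zero]
    positivity
  have h1 : 2 * (1 / (4 * S)) * S ≤ 1 := by
    rw [show 2 * (1 / (4 * S)) * S = 1 / 2 by field_simp; norm_num]
    norm_num
  have h2 := sum_exp_neg_sign_le a (1 / (4 * S)) (by positivity) h1
  rw [← hS, show -(1 / (4 * S)) * S + 2 * (1 / (4 * S)) ^ 2 * S ^ 2 = -(1 / 8) by
    field_simp; norm_num] at h2
  have h5 : ∑ G : Fin m → ι → Bool, Real.exp (-(1 / (4 * S)) * signForm G a) ≤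
      (2 ^ Fintype.card ι * Real.exp (-(1 / 8))) ^ m := by
    rw [sum_exp_signForm]
    gcongr
  have h6 : ((Finset.univ.filter fun G : Fin m → ι → Bool => signForm G a < S * m / 4).card : ℝ) *
      Real.exp (-(m / 16)) ≤ ∑ G : Fin m → ι → Bool, Real.exp (-(1 / (4 * S)) * signForm G a) := by
    rw [← nsmul_eq_mul, ← Finset.sum_const]
    refine (Finset.sum_le_sum fun G hG => ?_).trans
      (Finset.sum_le_sum_of_subset_of_nonneg (Finset.filter_subset _ _) fun _ _ _ => by positivity)
    rw [Finset.mem_filter] at hG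
    gcongr
    rw [neg_mul, neg_le_neg_iff, one_div_mul_eq_div, div_le_iff₀ (by positivity)]
    linarith [hG.2]
  have h7 := h6.trans h5
  rw [← le_div_iff₀ (by positivity)] at h7
  refine h7.trans (le_of_eq ?_)
  rw [mul_pow, mul_div_assoc, ← Real.exp_nat_mul, ← Real.exp_sub]
  congr 2
  ring

/-- Existence of a good sign matrix for two finite families of vectors. -/
theorem exists_sign_matrix {ι Y J : Type} [Fintype ι] [Fintype Y] [Fintype J] (m : ℕ)
    (y : Y → ι → ℂ) (v : J → ι → ℂ) (R : ℝ) (hR : 0 < R) (hv : ∀ j, ∑ i, ‖v j i‖ ^ 2 ≤ R)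
    (hcard : (Fintype.card Y + Fintype.card J : ℝ) * Real.exp (-(m / 16 : ℝ)) < 1) :
    ∃ G : Fin m → ι → Bool, (∀ j, signForm G (v j) ≤ 6 * R * m) ∧
      ∀ k, (∑ i, ‖y k i‖ ^ 2) * m / 4 ≤ signForm G (y k) := by
  by_contra! hcon
  have hsub : (Finset.univ : Finset (Fin m → ι → Bool)) ⊆
      (Finset.univ.biUnion fun j => Finset.univ.filter fun G : Fin m → ι → Bool =>
        6 * R * m ≤ signForm G (v j)) ∪
      (Finset.univ.biUnion fun k => Finset.univ.filter fun G : Fin m → ι → Bool =>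
        signForm G (y k) < (∑ i, ‖y k i‖ ^ 2) * m / 4) := by
    intro G _
    rw [Finset.mem_union, Finset.mem_biUnion, Finset.mem_biUnion]
    by_cases h : ∀ j, signForm G (v j) ≤ 6 * R * m
    · obtain ⟨k, hk⟩ := hcon G h
      exact Or.inr ⟨k, Finset.mem_univ _, by simpa using hk⟩
    · push Not at h
      obtain ⟨j, hj⟩ := h
      exact Or.inl ⟨j, Finset.mem_univ _, by simpa using hj.le⟩
  have h1 := (Finset.card_le_card hsub).trans ((Finset.card_union_le _ _).trans
    (add_le_add Finset.card_biUnion_le Finset.card_biUnion_le))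
  have h2 : ((Finset.univ : Finset (Fin m → ι → Bool)).card : ℝ) ≤
      ∑ j : J, ((2 ^ Fintype.card ι) ^ m * Real.exp (-(m : ℝ))) +
      ∑ k : Y, ((2 ^ Fintype.card ι) ^ m * Real.exp (-(m / 16 : ℝ))) := by
    refine (Nat.cast_le (α := ℝ).mpr h1).trans ?_
    push_cast
    gcongr with j _ k _
    · exact card_signForm_large (v j) R hR (hv j)
    · exact card_signForm_small (y k)
  have h3 : ((Finset.univ : Finset (Fin m → ι → Bool)).card : ℝ) = (2 ^ Fintype.card ι) ^ m := by
    simp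
  have h4 : Real.exp (-(m : ℝ)) ≤ Real.exp (-(m / 16 : ℝ)) := by
    gcongr
    have : (0 : ℝ) ≤ m := by positivity
    linarith
  rw [h3, Finset.sum_const, Finset.sum_const, Finset.card_univ, Finset.card_univ, nsmul_eq_mul,
    nsmul_eq_mul] at h2
  set P : ℝ := (2 ^ Fintype.card ι) ^ m with hP
  have hP0 : 0 < P := by positivity
  have h5 : P ≤ P * ((Fintype.card Y + Fintype.card J : ℝ) * Real.exp (-(m / 16 : ℝ))) := by
    refine h2.trans ?_
    have : (Fintype.card J : ℝ) * (P * Real.exp (-(m : ℝ))) ≤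
      (Fintype.card J : ℝ) * (P * Real.exp (-(m / 16 : ℝ))) := by gcongr
    linarith
  have h6 := (mul_lt_mul_iff_right₀ hP0).mpr hcard
  linarith

/-- A deterministic form of Maurey's empirical approximation. -/
theorem exists_average_near {E κ : Type} [NormedAddCommGroup E] [InnerProductSpace ℝ E]
    [Fintype κ] (w : κ → ℝ) (P : κ → E) (R : ℝ) (hw : ∀ k, 0 ≤ w k)
    (hw1 : ∑ k, w k = 1) (hP : ∀ k, ‖P k - ∑ l, w l • P l‖ ^ 2 ≤ R) (s : ℕ) :
    ∃ a : Fin s → κ, ‖∑ l, (P (a l) - ∑ l, w l • P l)‖ ^ 2 ≤ s * R := by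
  set x := ∑ l, w l • P l with hx
  induction s with
  | zero => exact ⟨Fin.elim0, by simp⟩
  | succ s ih =>
    obtain ⟨a, ha⟩ := ih
    set z := ∑ l, (P (a l) - x) with hz
    have h0 : ∑ k, w k * inner ℝ z (P k - x) = 0 := by
      have : ∑ k, w k • (P k - x) = 0 := by
        simp only [smul_sub, Finset.sum_sub_distrib, ← Finset.sum_smul, hw1, one_smul]
        rw [← hx, sub_self]
      simp_rw [← real_inner_smul_right, ← inner_sum, this, inner_zero_right]
    have h1 : ∃ k, inner ℝ z (P k - x) ≤ 0 := by
      by_contra! hc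
      have h2 : ∀ k ∈ Finset.univ, 0 ≤ w k * inner ℝ z (P k - x) :=
        fun k _ => mul_nonneg (hw k) (hc k).le
      rw [Finset.sum_eq_zero_iff_of_nonneg h2] at h0
      have h3 : ∀ k, w k = 0 := fun k =>
        (mul_eq_zero.mp (h0 k (Finset.mem_univ _))).resolve_right (hc k).ne'
      simp [h3] at hw1
    obtain ⟨k, hk⟩ := h1
    refine ⟨Fin.snoc a k, ?_⟩
    rw [Fin.sum_univ_castSucc]
    simp only [Fin.snoc_castSucc, Fin.snoc_last]
    rw [← hz, norm_add_sq_real]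
    push_cast
    nlinarith [hP k]

/-- The nonnegative weights in the decomposition of `z / 2` along the four directions
`1, I, -1, -I`. -/
def phaseWeight (z : ℂ) (k : Fin 4) : ℝ :=
  ![max z.re 0 / 2, max z.im 0 / 2, max (-z.re) 0 / 2, max (-z.im) 0 / 2] k

theorem phaseWeight_nonneg (z : ℂ) (k : Fin 4) : 0 ≤ phaseWeight z k := by
  fin_cases k <;> simp [phaseWeight] <;> positivity

theorem sum_phaseWeight_le (z : ℂ) : ∑ k, phaseWeight z k ≤ ‖z‖ := by
  have h1 := Complex.abs_re_le_norm z
  have h2 := Complex.abs_im_le_norm z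
  have h3 : ∀ x : ℝ, max x 0 + max (-x) 0 = |x| := fun x => by
    rcases le_total 0 x with h | h
    · rw [max_eq_left h, max_eq_right (by linarith), abs_of_nonneg h, add_zero]
    · rw [max_eq_right h, max_eq_left (by linarith), abs_of_nonpos h, zero_add]
  have := h3 z.re
  have := h3 z.im
  simp only [phaseWeight, Fin.sum_univ_four, Matrix.cons_val]
  linarith

theorem sum_phaseWeight_mul (z : ℂ) :
    ∑ k, (phaseWeight z k : ℂ) * Complex.I ^ (k : ℕ) = z / 2 := by
  have h3 : ∀ x : ℝ, max x 0 - max (-x) 0 = x := fun x => by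
    rcases le_total 0 x with h | h
    · rw [max_eq_left h, max_eq_right (by linarith), sub_zero]
    · rw [max_eq_right h, max_eq_left (by linarith)]; ring
  have hr := h3 z.re
  have hi := h3 z.im
  simp only [phaseWeight, Fin.sum_univ_four, Matrix.cons_val]
  have h4 : (Complex.I ^ 3) = -Complex.I := by rw [pow_succ, Complex.I_sq]; ring
  simp only [Fin.coe_ofNat_eq_mod, Nat.zero_mod, pow_zero, Nat.one_mod, pow_one, Nat.reduceMod,
    Complex.I_sq, h4]
  apply Complex.ext
  · simp; linarith
  · simp; linarith

theorem sum_I_pow_four : ∑ k : Fin 4, Complex.I ^ (k : ℕ) = 0 := by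
  have h4 : (Complex.I ^ 3) = -Complex.I := by rw [pow_succ, Complex.I_sq]; ring
  simp only [Fin.sum_univ_four, Fin.coe_ofNat_eq_mod, Nat.zero_mod, pow_zero, Nat.one_mod, pow_one,
    Nat.reduceMod, Complex.I_sq, h4]
  ring

/-- Half of an absolutely convex combination is a convex combination of rotated vectors. -/
theorem exists_convex_weights {J : Type} [Fintype J] [Nonempty J] (μ : J → ℂ)
    (hμ : ∑ j, ‖μ j‖ ≤ 1) :
    ∃ w : J × Fin 4 → ℝ, (∀ k, 0 ≤ w k) ∧ ∑ k, w k = 1 ∧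
      ∀ u : J → ℂ, ∑ k, (w k : ℂ) * (Complex.I ^ (k.2 : ℕ) * u k.1) = (∑ j, μ j * u j) / 2 := by
  set W := ∑ j, ∑ k, phaseWeight (μ j) k with hW
  have hW1 : W ≤ 1 := (Finset.sum_le_sum fun j _ => sum_phaseWeight_le (μ j)).trans hμ
  have hJ : (0 : ℝ) < Fintype.card J := by exact_mod_cast Fintype.card_pos
  set e : ℝ := (1 - W) / (4 * Fintype.card J) with he
  have he0 : 0 ≤ e := div_nonneg (by linarith) (by positivity)
  refine ⟨fun k => phaseWeight (μ k.1) k.2 + e,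
    fun k => add_nonneg (phaseWeight_nonneg _ _) he0, ?_, fun u => ?_⟩
  · rw [Finset.sum_add_distrib, Fintype.sum_prod_type, ← hW]
    simp only [Finset.sum_const, Finset.card_univ, Fintype.card_prod, Fintype.card_fin,
      nsmul_eq_mul]
    rw [he]
    push_cast
    field_simp
    ring
  · rw [Fintype.sum_prod_type, Finset.sum_div]
    refine Finset.sum_congr rfl fun j _ => ?_
    push_cast
    have h1 := sum_phaseWeight_mul (μ j)
    have : ∀ k : Fin 4, ((phaseWeight (μ j) k : ℂ) + e) * (Complex.I ^ (k : ℕ) * u j) =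
        ((phaseWeight (μ j) k : ℂ) * Complex.I ^ (k : ℕ)) * u j +
          Complex.I ^ (k : ℕ) * (e * u j) := fun k => by ring
    simp only [this]
    rw [Finset.sum_add_distrib, ← Finset.sum_mul, ← Finset.sum_mul, h1, sum_I_pow_four]
    ring

theorem norm_sq_sum_le_of_abs_convex {ι J : Type} [Fintype ι] [Fintype J]
    (v : J → ι → ℂ) (R : ℝ) (hR : 0 ≤ R) (hv : ∀ j, ∑ i, ‖v j i‖ ^ 2 ≤ R) (μ : J → ℂ)
    (hμ : ∑ j, ‖μ j‖ ≤ 1) : ∑ i, ‖∑ j, μ j * v j i‖ ^ 2 ≤ R := by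
  set V : J → EuclideanSpace ℂ ι := fun j => WithLp.toLp 2 (v j) with hV
  have h1 : ∀ j, ‖V j‖ ≤ √R := fun j => by
    rw [EuclideanSpace.norm_eq]
    exact Real.sqrt_le_sqrt (hv j)
  have h2 : ‖∑ j, μ j • V j‖ ≤ √R := by
    refine (norm_sum_le _ _).trans ?_
    calc ∑ j, ‖μ j • V j‖ ≤ ∑ j, ‖μ j‖ * √R := by
          gcongr with j
          rw [norm_smul]
          gcongr
          exact h1 j
      _ ≤ 1 * √R := by rw [← Finset.sum_mul]; gcongr
      _ = √R := one_mul _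
  have h3 : ‖∑ j, μ j • V j‖ ^ 2 ≤ R := by
    rw [← Real.sq_sqrt hR]
    gcongr
  rw [EuclideanSpace.norm_sq_eq] at h3
  simpa [hV] using h3

theorem kernel_bound_of_signForm {ι J : Type} [Fintype ι] [Fintype J] [Nonempty J] {m s : ℕ}
    (hm : 1 ≤ m) (hs : 1 ≤ s) (v : J → ι → ℂ) (R : ℝ) (hR : 0 < R)
    (hv : ∀ j, ∑ i, ‖v j i‖ ^ 2 ≤ R) (G : Fin m → ι → Bool)
    (hG : ∀ j, signForm G (v j) ≤ 6 * R * m)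
    (hG' : ∀ a : Fin s → J × Fin 4,
      (∑ i, ‖∑ l, Complex.I ^ ((a l).2 : ℕ) * v (a l).1 i‖ ^ 2) * m / 4 ≤
        signForm G (fun i => ∑ l, Complex.I ^ ((a l).2 : ℕ) * v (a l).1 i))
    (μ : J → ℂ) (hμ : ∑ j, ‖μ j‖ ≤ 1)
    (hker : ∀ l, ∑ i, (boolSign (G l i) : ℂ) * ∑ j, μ j * v j i = 0) :
    ∑ i, ‖∑ j, μ j * v j i‖ ^ 2 ≤ 1600 * R / s := by
  obtain ⟨w, hw0, hw1, hw⟩ := exists_convex_weights μ hμ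
  have hm' : (0 : ℝ) < m := by exact_mod_cast hm
  have hs' : (0 : ℝ) < s := by exact_mod_cast hs
  set c : ℝ := 1 / √(6 * m) with hc
  have hc2 : c ^ 2 = 1 / (6 * m) := by
    rw [hc, div_pow, Real.sq_sqrt (by positivity), one_pow]
  set x : ι → ℂ := fun i => ∑ j, μ j * v j i with hx
  set P : J × Fin 4 → EuclideanSpace ℂ (ι ⊕ Fin m) := fun k => WithLp.toLp 2
    (Sum.elim (fun i => Complex.I ^ (k.2 : ℕ) * v k.1 i)
      (fun l => (c : ℂ) * ∑ i, (boolSign (G l i) : ℂ) * (Complex.I ^ (k.2 : ℕ) * v k.1 i))) with hP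
  have hPn : ∀ k, ‖P k‖ ^ 2 ≤ 2 * R := fun k => by
    rw [EuclideanSpace.norm_sq_eq, Fintype.sum_sum_type]
    have e1 : ∀ l, (c : ℂ) * ∑ i, (boolSign (G l i) : ℂ) * (Complex.I ^ (k.2 : ℕ) * v k.1 i) =
        (c : ℂ) * (Complex.I ^ (k.2 : ℕ) * ∑ i, (boolSign (G l i) : ℂ) * v k.1 i) := fun l => by
      rw [Finset.mul_sum _ _ (Complex.I ^ _)]
      congr 1
      exact Finset.sum_congr rfl fun i _ => by ring
    simp only [hP, Sum.elim_inl, Sum.elim_inr, e1, norm_mul, norm_pow, Complex.norm_I, one_pow,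
      one_mul, Complex.norm_real, mul_pow, Real.norm_eq_abs, sq_abs]
    rw [← Finset.mul_sum, hc2]
    have := hG k.1
    rw [signForm] at this
    have h6 : 1 / (6 * (m : ℝ)) * ∑ l, ‖∑ i, (boolSign (G l i) : ℂ) * v k.1 i‖ ^ 2 ≤ R := by
      rw [one_div_mul_eq_div, div_le_iff₀ (by positivity)]
      linarith
    linarith [hv k.1]
  have hxbar : ∑ k, w k • P k = WithLp.toLp 2 (Sum.elim (fun i => x i / 2) (fun _ => 0)) := by
    ext i
    rw [WithLp.ofLp_sum, Finset.sum_apply]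
    rcases i with i | l
    · simp only [hP, PiLp.smul_apply, Sum.elim_inl, Complex.real_smul]
      exact hw fun j => v j i
    · simp only [hP, PiLp.smul_apply, Sum.elim_inr, Complex.real_smul]
      have : ∀ k : J × Fin 4, (w k : ℂ) * ((c : ℂ) * ∑ i, (boolSign (G l i) : ℂ) *
          (Complex.I ^ (k.2 : ℕ) * v k.1 i)) =
          (w k : ℂ) * (Complex.I ^ (k.2 : ℕ) *
            ((c : ℂ) * ∑ i, (boolSign (G l i) : ℂ) * v k.1 i)) := fun k => by
        congr 1
        simp only [Finset.mul_sum]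
        exact Finset.sum_congr rfl fun i _ => by ring
      simp only [this]
      rw [hw fun j => (c : ℂ) * ∑ i, (boolSign (G l i) : ℂ) * v j i]
      have h0 := hker l
      have : ∑ j, μ j * ((c : ℂ) * ∑ i, (boolSign (G l i) : ℂ) * v j i) =
          c * ∑ i, (boolSign (G l i) : ℂ) * ∑ j, μ j * v j i := by
        simp only [Finset.mul_sum]
        rw [Finset.sum_comm]
        exact Finset.sum_congr rfl fun i _ => Finset.sum_congr rfl fun j _ => by ring
      rw [this, h0]
      simp
  have hdev : ∀ k, ‖P k - ∑ l, w l • P l‖ ^ 2 ≤ 8 * R := fun k => by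
    have h1 : ‖∑ l, w l • P l‖ ≤ √(2 * R) := by
      refine (norm_sum_le _ _).trans ?_
      calc ∑ l, ‖w l • P l‖ ≤ ∑ l, w l * √(2 * R) := by
            gcongr with l
            rw [norm_smul, Real.norm_of_nonneg (hw0 l)]
            exact mul_le_mul_of_nonneg_left (Real.le_sqrt_of_sq_le (hPn l)) (hw0 l)
        _ = √(2 * R) := by rw [← Finset.sum_mul, hw1, one_mul]
    have h2 : ‖P k - ∑ l, w l • P l‖ ≤ 2 * √(2 * R) := by
      have := norm_sub_le (P k) (∑ l, w l • P l)
      have := Real.le_sqrt_of_sq_le (hPn k)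
      linarith
    calc _ ≤ (2 * √(2 * R)) ^ 2 := by gcongr
      _ = 8 * R := by rw [mul_pow, Real.sq_sqrt (by positivity)]; ring
  obtain ⟨a, ha⟩ := exists_average_near w P (8 * R) hw0 hw1 hdev s
  set y : ι → ℂ := fun i => ∑ l, Complex.I ^ ((a l).2 : ℕ) * v (a l).1 i with hy
  have hsum : ∑ l, (P (a l) - ∑ l, w l • P l) = WithLp.toLp 2
      (Sum.elim (fun i => y i - s * (x i / 2))
        (fun l => (c : ℂ) * ∑ i, (boolSign (G l i) : ℂ) * y i)) := by
    rw [hxbar]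
    ext i
    rw [WithLp.ofLp_sum, Finset.sum_apply]
    rcases i with i | l
    · simp [hP, hy]
    · simp only [hP, hy, PiLp.sub_apply, Sum.elim_inr, sub_zero]
      simp only [Finset.mul_sum]
      rw [Finset.sum_comm]
  rw [hsum, EuclideanSpace.norm_sq_eq, Fintype.sum_sum_type] at ha
  simp only [Sum.elim_inl, Sum.elim_inr, norm_mul, mul_pow, Complex.norm_real, Real.norm_eq_abs,
    sq_abs] at ha
  rw [← Finset.mul_sum, hc2] at ha
  have h1 := hG' a
  change (∑ i, ‖y i‖ ^ 2) * m / 4 ≤ signForm G y at h1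
  change ∑ i, ‖y i - s * (x i / 2)‖ ^ 2 + 1 / (6 * m) * signForm G y ≤ _ at ha
  have h2 : 1 / (6 * (m : ℝ)) * ((∑ i, ‖y i‖ ^ 2) * m / 4) = (∑ i, ‖y i‖ ^ 2) / 24 := by
    field_simp
    ring
  have h3 : (∑ i, ‖y i‖ ^ 2) / 24 ≤ 1 / (6 * m) * signForm G y := by
    rw [← h2]; gcongr
  have h4 : ∀ i, (s : ℝ) ^ 2 / 4 * ‖x i‖ ^ 2 ≤
      2 * ‖y i - s * (x i / 2)‖ ^ 2 + 2 * ‖y i‖ ^ 2 := fun i => by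
    have h5 : ‖(s : ℂ) * (x i / 2)‖ ≤ ‖y i - s * (x i / 2)‖ + ‖y i‖ := by
      have := norm_sub_le (y i) (y i - s * (x i / 2))
      rw [sub_sub_cancel] at this
      linarith
    have h6 : ‖(s : ℂ) * (x i / 2)‖ = s / 2 * ‖x i‖ := by
      rw [norm_mul, norm_div]
      simp
      ring
    rw [h6] at h5
    have h7 : (s / 2 * ‖x i‖) ^ 2 ≤ (‖y i - s * (x i / 2)‖ + ‖y i‖) ^ 2 := by gcongr
    nlinarith [sq_nonneg (‖y i - s * (x i / 2)‖ - ‖y i‖)]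
  have h5 := Finset.sum_le_sum fun i (_ : i ∈ Finset.univ) => h4 i
  rw [← Finset.mul_sum, Finset.sum_add_distrib, ← Finset.mul_sum, ← Finset.mul_sum] at h5
  have hA : 0 ≤ ∑ i, ‖y i‖ ^ 2 := by positivity
  have hB : 0 ≤ ∑ i, ‖y i - s * (x i / 2)‖ ^ 2 := by positivity
  have h6 : (s : ℝ) ^ 2 / 4 * ∑ i, ‖x i‖ ^ 2 ≤ 400 * (s * R) := by linarith
  rw [le_div_iff₀ hs']
  have h7 : s * ((∑ i, ‖x i‖ ^ 2) * s) ≤ s * (1600 * R) := by linarith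
  exact le_of_mul_le_mul_left h7 hs'

/-- A Gelfand-width bound for absolutely convex hulls of finitely many points. -/
theorem exists_sign_matrix_kernel_bound {ι J : Type} [Fintype ι] [Fintype J] [Nonempty J] {m : ℕ}
    (hm : 1 ≤ m) (v : J → ι → ℂ) (R : ℝ) (hR : 0 < R)
    (hv : ∀ j, ∑ i, ‖v j i‖ ^ 2 ≤ R) :
    ∃ G : Fin m → ι → Bool, ∀ μ : J → ℂ, ∑ j, ‖μ j‖ ≤ 1 →
      (∀ l, ∑ i, (boolSign (G l i) : ℂ) * ∑ j, μ j * v j i = 0) →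
      ∑ i, ‖∑ j, μ j * v j i‖ ^ 2 ≤ 51200 * R * (Real.log (4 * Fintype.card J) + 1) / m := by
  have hm' : (0 : ℝ) < m := by exact_mod_cast hm
  have hJ : (1 : ℝ) ≤ Fintype.card J := by exact_mod_cast Fintype.card_pos
  set L := Real.log (4 * Fintype.card J) + 1 with hL
  have hlog : 0 ≤ Real.log (4 * Fintype.card J) := Real.log_nonneg (by linarith)
  have hL1 : 1 ≤ L := by linarith
  set q : ℝ := m / 16 / L with hq
  have hq0 : 0 ≤ q := by positivity
  rcases Nat.eq_zero_or_pos ⌊q⌋₊ with h0 | hpos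
  · refine ⟨fun _ _ => true, fun μ hμ _ => ?_⟩
    refine (norm_sq_sum_le_of_abs_convex v R hR.le hv μ hμ).trans ?_
    rw [Nat.floor_eq_zero, hq, div_lt_one (by linarith)] at h0
    rw [le_div_iff₀ hm']
    nlinarith
  · set s := ⌊q⌋₊ with hs
    have hs1 : (1 : ℝ) ≤ s := by exact_mod_cast hpos
    have hsq : (s : ℝ) ≤ q := Nat.floor_le hq0
    have hqs : q < s + 1 := Nat.lt_floor_add_one q
    have hcard : ((Fintype.card (Fin s → J × Fin 4) : ℝ) + Fintype.card J) *
        Real.exp (-(m / 16 : ℝ)) < 1 := by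
      have e1 : (Fintype.card (Fin s → J × Fin 4) : ℝ) = (4 * Fintype.card J : ℝ) ^ s := by
        simp [mul_comm]
      have e2 : (Fintype.card J : ℝ) ≤ (4 * Fintype.card J : ℝ) ^ s := by
        calc (Fintype.card J : ℝ) ≤ (4 * Fintype.card J : ℝ) ^ 1 := by rw [pow_one]; linarith
          _ ≤ _ := pow_le_pow_right₀ (by linarith) hpos
      have e3 : (4 * Fintype.card J : ℝ) ^ s = Real.exp (s * (L - 1)) := by
        rw [hL, add_sub_cancel_right, Real.exp_nat_mul, Real.exp_log (by linarith)]
      have e4 : (s : ℝ) * L ≤ m / 16 := by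
        rw [hq, le_div_iff₀ (by linarith)] at hsq
        exact hsq
      have e5 : (2 : ℝ) < Real.exp 1 := by
        have := Real.exp_one_gt_d9
        linarith
      calc _ ≤ (2 * Real.exp (s * (L - 1))) * Real.exp (-(m / 16 : ℝ)) := by
            gcongr
            rw [e1, ← e3]
            linarith
        _ < (Real.exp 1 * Real.exp (s * (L - 1))) * Real.exp (-(m / 16 : ℝ)) := by gcongr
        _ = Real.exp (1 + s * (L - 1) + -(m / 16)) := by rw [← Real.exp_add, ← Real.exp_add]
        _ ≤ 1 := by
            rw [Real.exp_le_one_iff]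
            nlinarith
    obtain ⟨G, hG, hG'⟩ := exists_sign_matrix m
      (fun (a : Fin s → J × Fin 4) i => ∑ l, Complex.I ^ ((a l).2 : ℕ) * v (a l).1 i) v R hR hv
      hcard
    refine ⟨G, fun μ hμ hker => ?_⟩
    refine (kernel_bound_of_signForm hm hpos v R hR hv G hG hG' μ hμ hker).trans ?_
    rw [div_le_div_iff₀ (by linarith) hm']
    have : (m : ℝ) / 32 / L ≤ s := by
      have : (m : ℝ) / 32 / L = q / 2 := by rw [hq]; ring
      linarith
    rw [div_le_iff₀ (by linarith)] at this
    nlinarith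

/-- Approximation by a subspace, dually to the vanishing of annihilating functionals. -/
theorem exists_mem_forall_norm_sub_le {J : Type} [Fintype J] (L : Submodule ℂ (J → ℂ))
    (F : J → ℂ) {δ δ' : ℝ} (hδ : δ < δ')
    (h : ∀ μ : J → ℂ, ∑ j, ‖μ j‖ ≤ 1 → (∀ u ∈ L, ∑ j, μ j * u j = 0) → ‖∑ j, μ j * F j‖ ≤ δ) :
    ∃ u ∈ L, ∀ j, ‖F j - u j‖ ≤ δ' := by
  have : IsClosed (L : Set (J → ℂ)) := L.closed_of_finiteDimensional
  obtain ⟨g, hg1, hg2⟩ := exists_dual_vector'' ℂ (L.mkQ F)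
  set μ : J → ℂ := fun j => g (L.mkQ (Pi.single j 1)) with hμ
  have hgu : ∀ u : J → ℂ, g (L.mkQ u) = ∑ j, μ j * u j := fun u => by
    conv_lhs => rw [pi_eq_sum_univ' u]
    simp only [map_sum, hμ]
    refine Finset.sum_congr rfl fun j _ => ?_
    rw [map_smul, map_smul, smul_eq_mul, mul_comm]
  have hbound : ∀ u : J → ℂ, ‖g (L.mkQ u)‖ ≤ ‖u‖ := fun u => by
    calc ‖g (L.mkQ u)‖ ≤ ‖g‖ * ‖L.mkQ u‖ := g.le_opNorm _
      _ ≤ 1 * ‖u‖ := by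
          gcongr
          exact Submodule.Quotient.norm_mk_le L u
      _ = ‖u‖ := one_mul _
  have hμ1 : ∑ j, ‖μ j‖ ≤ 1 := by
    set u : J → ℂ := fun j => (‖μ j‖ : ℂ) / μ j with hu
    have h1 : ∑ j, μ j * u j = ((∑ j, ‖μ j‖ : ℝ) : ℂ) := by
      push_cast
      refine Finset.sum_congr rfl fun j _ => ?_
      by_cases h0 : μ j = 0
      · simp [h0]
      · rw [hu]; field_simp
    have h2 : ‖u‖ ≤ 1 := by
      rw [pi_norm_le_iff_of_nonneg zero_le_one]
      intro j
      rw [hu]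
      simp only [norm_div, Complex.norm_real, norm_norm]
      exact div_self_le_one _
    have h3 := hbound u
    rw [hgu, h1, Complex.norm_real, Real.norm_of_nonneg (by positivity)] at h3
    exact h3.trans h2
  have hz : ∀ u ∈ L, ∑ j, μ j * u j = 0 := fun u hu => by
    rw [← hgu, (Submodule.Quotient.mk_eq_zero L).mpr hu |> fun h => (h : L.mkQ u = 0), map_zero]
  have h1 := h μ hμ1 hz
  rw [← hgu, hg2] at h1
  have h2 : ‖L.mkQ F‖ < δ' := by
    refine lt_of_le_of_lt ?_ hδ
    simpa using h1
  obtain ⟨z, hz1, hz2⟩ := Submodule.Quotient.norm_mk_lt (S := L) (L.mkQ F) (sub_pos.mpr h2)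
  rw [add_sub_cancel] at hz2
  refine ⟨F - z, ?_, fun j => ?_⟩
  · rw [← Submodule.Quotient.mk_eq_zero, Submodule.Quotient.mk_sub, hz1]
    simp
  · rw [Pi.sub_apply, sub_sub_cancel]
    exact (norm_le_pi_norm z j).trans hz2.le

/-- The coefficients `1, 1, 2^{-r}, 3^{-r}, …` of the univariate Bernoulli kernel. -/
def bernCoeff (r : ℝ) (k : ℕ) : ℝ := if k = 0 then 1 else (k : ℝ) ^ (-r)

/-- Second differences of `bernCoeff`. -/
def bernDiff (r : ℝ) (j : ℕ) : ℝ := bernCoeff r (j - 1) - 2 * bernCoeff r j + bernCoeff r (j + 1)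

/-- Coefficients of a dyadic block in the expansion of the Bernoulli kernel into Fejér kernels. -/
def dyadCoeff (r : ℝ) (s : ℕ) (k : ℤ) : ℝ :=
  ∑ j ∈ Finset.Ico (2 ^ s) (2 ^ (s + 1)), bernDiff r j * ((j - k.natAbs : ℕ) : ℝ)

theorem bernCoeff_nonneg (r : ℝ) (k : ℕ) : 0 ≤ bernCoeff r k := by
  unfold bernCoeff; split_ifs <;> positivity

theorem bernCoeff_succ_le {r : ℝ} (hr : 0 ≤ r) (k : ℕ) : bernCoeff r (k + 1) ≤ bernCoeff r k := by
  unfold bernCoeff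
  rcases Nat.eq_zero_or_pos k with rfl | hk
  · simp
  · rw [if_neg (by omega), if_neg (by omega)]
    apply Real.rpow_le_rpow_of_nonpos (by positivity) (by push_cast; linarith) (by linarith)

theorem mul_bernCoeff_sub_le {r : ℝ} (hr1 : r ≤ 1) (n : ℕ) :
    n * (bernCoeff r n - bernCoeff r (n + 1)) ≤ bernCoeff r (n + 1) := by
  rcases Nat.eq_zero_or_pos n with rfl | hk
  · simpa using bernCoeff_nonneg r 1
  · have hn : (0 : ℝ) < n := by positivity
    have h1 : (n : ℝ) / (n + 1) ≤ ((n : ℝ) / (n + 1)) ^ r := by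
      conv_lhs => rw [← Real.rpow_one ((n : ℝ) / (n + 1))]
      exact Real.rpow_le_rpow_of_exponent_ge (by positivity)
        (by rw [div_le_one (by positivity)]; linarith) hr1
    have h2 : bernCoeff r (n + 1) = ((n : ℝ) / (n + 1)) ^ r * bernCoeff r n := by
      unfold bernCoeff
      rw [if_neg (by omega), if_neg (by omega), Real.div_rpow hn.le (by positivity),
        Real.rpow_neg hn.le, Real.rpow_neg (by positivity)]
      push_cast
      field_simp
    have h3 : (n : ℝ) / (n + 1) * bernCoeff r n ≤ bernCoeff r (n + 1) := by
      rw [h2]; gcongr; exact bernCoeff_nonneg r n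
    have h4 : (n : ℝ) / (n + 1) * bernCoeff r n * (n + 1) = n * bernCoeff r n := by field_simp
    have h5 : (n : ℝ) * bernCoeff r n ≤ bernCoeff r (n + 1) * (n + 1) := by
      rw [← h4]; gcongr
    linarith

theorem tendsto_bernCoeff {r : ℝ} (hr : 0 < r) :
    Filter.Tendsto (bernCoeff r) Filter.atTop (nhds 0) := by
  have h := (tendsto_rpow_neg_atTop hr).comp (tendsto_natCast_atTop_atTop (R := ℝ))
  refine h.congr' ?_
  filter_upwards [Filter.eventually_gt_atTop 0] with n hn
  simp [bernCoeff, hn.ne']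

theorem bernDiff_nonneg {r : ℝ} (hr : 0 ≤ r) {j : ℕ} (hj : 2 ≤ j) : 0 ≤ bernDiff r j := by
  obtain ⟨n, rfl⟩ := Nat.exists_eq_add_of_le' hj
  rw [bernDiff, show n + 2 - 1 = n + 1 by omega]
  simp only [bernCoeff]
  rw [if_neg (by omega), if_neg (by omega), if_neg (by omega)]
  have h1 : (((n + 2 : ℕ) : ℝ) ^ (-r)) ^ 2 ≤
      ((n + 1 : ℕ) : ℝ) ^ (-r) * ((n + 2 + 1 : ℕ) : ℝ) ^ (-r) := by
    rw [sq, ← Real.mul_rpow (by positivity) (by positivity),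
      ← Real.mul_rpow (by positivity) (by positivity)]
    refine Real.rpow_le_rpow_of_nonpos (by positivity) ?_ (by linarith)
    push_cast
    nlinarith
  have h2 : 0 ≤ ((n + 2 : ℕ) : ℝ) ^ (-r) := by positivity
  have h3 : 0 ≤ ((n + 1 : ℕ) : ℝ) ^ (-r) := by positivity
  have h4 : 0 ≤ ((n + 2 + 1 : ℕ) : ℝ) ^ (-r) := by positivity
  have h5 : (2 * ((n + 2 : ℕ) : ℝ) ^ (-r)) ^ 2 ≤
      (((n + 1 : ℕ) : ℝ) ^ (-r) + ((n + 2 + 1 : ℕ) : ℝ) ^ (-r)) ^ 2 := by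
    nlinarith [sq_nonneg (((n + 1 : ℕ) : ℝ) ^ (-r) - ((n + 2 + 1 : ℕ) : ℝ) ^ (-r))]
  have h6 := abs_le_of_sq_le_sq h5 (by positivity)
  have h7 := le_abs_self (2 * ((n + 2 : ℕ) : ℝ) ^ (-r))
  linarith

theorem sum_bernDiff (r : ℝ) (k n : ℕ) :
    ∑ j ∈ Finset.range (k + 1 + n), bernDiff r j * ((j - k : ℕ) : ℝ) =
      bernCoeff r k - bernCoeff r (k + n) - n * (bernCoeff r (k + n) - bernCoeff r (k + n + 1)) := by
  induction n with
  | zero =>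
    simp only [add_zero, Nat.cast_zero, zero_mul, sub_self]
    refine Finset.sum_eq_zero fun j hj => ?_
    rw [Nat.sub_eq_zero_of_le (by simp at hj; omega)]
    simp
  | succ n ih =>
    rw [← add_assoc, Finset.sum_range_succ, ih, bernDiff]
    have h1 : k + 1 + n - k = n + 1 := by omega
    have h2 : k + 1 + n - 1 = k + n := by omega
    rw [h1, h2, show k + 1 + n + 1 = k + n + 2 by ring, show k + 1 + n = k + n + 1 by ring,
      show k + (n + 1) = k + n + 1 by ring]
    push_cast
    ring

theorem sum_abs_bernDiff_le {r : ℝ} (hr : 0 ≤ r) (hr1 : r ≤ 1) (s : ℕ) :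
    ∑ j ∈ Finset.Ico (2 ^ s) (2 ^ (s + 1)), |bernDiff r j| * j ≤ 4 * (2 : ℝ) ^ (-(r * s)) := by
  rcases s with _ | s
  · have h2 : (2 : ℝ) ^ (-r) ≤ 1 := Real.rpow_le_one_of_one_le_of_nonpos (by norm_num) (by linarith)
    have h3 : (0 : ℝ) ≤ (2 : ℝ) ^ (-r) := by positivity
    simp [bernDiff, bernCoeff]
    rw [abs_le]
    norm_num
    constructor <;> linarith
  · have h1 : ∀ j ∈ Finset.Ico (2 ^ (s + 1)) (2 ^ (s + 1 + 1)),
        |bernDiff r j| * j ≤ 2 * (bernDiff r j * ((j - 2 ^ s : ℕ) : ℝ)) := fun j hj => by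
      rw [Finset.mem_Ico] at hj
      have h4 : 2 ^ (s + 1) = 2 * 2 ^ s := by ring
      have h5 : 1 ≤ 2 ^ s := Nat.one_le_two_pow
      have h6 := bernDiff_nonneg hr (j := j) (by omega)
      rw [abs_of_nonneg h6, mul_left_comm]
      have h7 : (j : ℝ) ≤ 2 * ((j - 2 ^ s : ℕ) : ℝ) := by
        exact_mod_cast (by omega : j ≤ 2 * (j - 2 ^ s))
      gcongr
    refine (Finset.sum_le_sum h1).trans ?_
    rw [← Finset.mul_sum]
    have h2 : ∑ j ∈ Finset.Ico (2 ^ (s + 1)) (2 ^ (s + 1 + 1)), bernDiff r j * ((j - 2 ^ s : ℕ) : ℝ)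
        ≤ ∑ j ∈ Finset.range (2 ^ (s + 1 + 1)), bernDiff r j * ((j - 2 ^ s : ℕ) : ℝ) := by
      refine Finset.sum_le_sum_of_subset_of_nonneg (fun j hj => by simp at hj ⊢; omega) ?_
      intro j _ _
      have h5 : 1 ≤ 2 ^ s := Nat.one_le_two_pow
      rcases le_or_gt 2 j with h | h
      · exact mul_nonneg (bernDiff_nonneg hr h) (by positivity)
      · rw [Nat.sub_eq_zero_of_le (by omega)]; simp
    have h3 := sum_bernDiff r (2 ^ s) (2 ^ (s + 1 + 1) - 2 ^ s - 1)
    have h5 : 1 ≤ 2 ^ s := Nat.one_le_two_pow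
    have h6 : 2 ^ (s + 1 + 1) = 4 * 2 ^ s := by ring
    rw [show 2 ^ s + 1 + (2 ^ (s + 1 + 1) - 2 ^ s - 1) = 2 ^ (s + 1 + 1) by omega] at h3
    have h7 := bernCoeff_nonneg r (2 ^ s + (2 ^ (s + 1 + 1) - 2 ^ s - 1))
    have h8 : 0 ≤ ((2 ^ (s + 1 + 1) - 2 ^ s - 1 : ℕ) : ℝ) *
        (bernCoeff r (2 ^ s + (2 ^ (s + 1 + 1) - 2 ^ s - 1)) -
          bernCoeff r (2 ^ s + (2 ^ (s + 1 + 1) - 2 ^ s - 1) + 1)) :=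
      mul_nonneg (by positivity) (sub_nonneg.2 (bernCoeff_succ_le hr _))
    have h9 : bernCoeff r (2 ^ s) = 2 ^ r * (2 : ℝ) ^ (-(r * ((s + 1 : ℕ) : ℝ))) := by
      rw [bernCoeff, if_neg (by positivity), ← Real.rpow_add (by norm_num)]
      push_cast
      rw [← Real.rpow_natCast, ← Real.rpow_mul (by norm_num)]
      congr 1; ring
    have h10 : (2 : ℝ) ^ r ≤ 2 := by
      conv_rhs => rw [← Real.rpow_one 2]
      exact Real.rpow_le_rpow_of_exponent_le (by norm_num) hr1
    have h11 : bernCoeff r (2 ^ s) ≤ 2 * (2 : ℝ) ^ (-(r * ((s + 1 : ℕ) : ℝ))) := by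
      rw [h9]; gcongr
    linarith

theorem abs_dyadCoeff_le {r : ℝ} (hr : 0 ≤ r) (hr1 : r ≤ 1) (s : ℕ) (k : ℤ) :
    |dyadCoeff r s k| ≤ 4 * (2 : ℝ) ^ (-(r * s)) := by
  refine le_trans ((Finset.abs_sum_le_sum_abs _ _).trans (Finset.sum_le_sum fun j _ => ?_))
    (sum_abs_bernDiff_le hr hr1 s)
  rw [abs_mul, Nat.abs_cast]
  gcongr
  omega

theorem dyadCoeff_eq_zero (r : ℝ) {s : ℕ} {k : ℤ} (hk : 2 ^ (s + 1) ≤ k.natAbs) :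
    dyadCoeff r s k = 0 := by
  refine Finset.sum_eq_zero fun j hj => ?_
  rw [Finset.mem_Ico] at hj
  rw [Nat.sub_eq_zero_of_le (by omega)]
  simp

theorem sum_dyadCoeff (r : ℝ) (S : ℕ) (k : ℤ) :
    ∑ s ∈ Finset.range S, dyadCoeff r s k =
      ∑ j ∈ Finset.range (2 ^ S), bernDiff r j * ((j - k.natAbs : ℕ) : ℝ) := by
  induction S with
  | zero => simp
  | succ S ih =>
    rw [Finset.sum_range_succ, ih, dyadCoeff, Finset.sum_range_add_sum_Ico]
    exact Nat.pow_le_pow_right (by norm_num) (by omega)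

theorem tendsto_sum_dyadCoeff {r : ℝ} (hr : 0 < r) (hr1 : r ≤ 1) (k : ℤ) :
    Filter.Tendsto (fun S => ∑ s ∈ Finset.range S, dyadCoeff r s k) Filter.atTop
      (nhds (bernCoeff r k.natAbs)) := by
  have hlim : Filter.Tendsto (fun J : ℕ => ∑ j ∈ Finset.range J,
      bernDiff r j * ((j - k.natAbs : ℕ) : ℝ)) Filter.atTop (nhds (bernCoeff r k.natAbs)) := by
    rw [← Filter.tendsto_add_atTop_iff_nat (k.natAbs + 1)]
    have h1 : Filter.Tendsto (fun n => bernCoeff r (k.natAbs + n)) Filter.atTop (nhds 0) :=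
      ((tendsto_bernCoeff hr).comp (Filter.tendsto_add_atTop_nat k.natAbs)).congr fun n => by
        simp [add_comm]
    have h1' := h1.comp (Filter.tendsto_add_atTop_nat 1)
    have h2 : Filter.Tendsto (fun n : ℕ => n * (bernCoeff r (k.natAbs + n) -
        bernCoeff r (k.natAbs + n + 1))) Filter.atTop (nhds 0) := by
      refine squeeze_zero (fun n => mul_nonneg (by positivity)
        (sub_nonneg.2 (bernCoeff_succ_le hr.le _))) (fun n => ?_) h1'
      have h3 := mul_bernCoeff_sub_le hr1 (k.natAbs + n)
      refine le_trans ?_ h3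
      have := sub_nonneg.2 (bernCoeff_succ_le hr.le (k.natAbs + n))
      gcongr
      omega
    have h4 := (tendsto_const_nhds (x := bernCoeff r k.natAbs)).sub h1 |>.sub h2
    simp only [sub_zero] at h4
    refine h4.congr fun n => ?_
    rw [← sum_bernDiff, add_comm n]
  refine (hlim.comp (tendsto_pow_atTop_atTop_of_one_lt (by norm_num : 1 < 2))).congr fun S => ?_
  rw [sum_dyadCoeff]; rfl

theorem integral_fourier_eq (n : ℤ) :
    ∫ x : AddCircle (2 * π), fourier n x = if n = 0 then ((2 * π : ℝ) : ℂ) else 0 := by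
  rw [AddCircle.volume_eq_smul_haarAddCircle, integral_smul_measure]
  split_ifs with h
  · subst h
    simp [ENNReal.toReal_ofReal, Real.pi_pos.le]
  · rw [integral_eq_zero_of_add_right_eq_neg (μ := AddCircle.haarAddCircle)
      (fourier_add_half_inv_index h Real.two_pi_pos), smul_zero]

theorem card_filter_sub_eq (j : ℕ) (k : ℤ) :
    ((Finset.range j ×ˢ Finset.range j).filter (fun x => (x.1 : ℤ) - x.2 = k)).card =
      j - k.natAbs := by
  rw [← Finset.card_range (j - k.natAbs)]
  refine Finset.card_bij' (fun x _ => min x.1 x.2)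
    (fun y _ => (y + k.toNat, y + (-k).toNat)) ?_ ?_ ?_ ?_
  · rintro ⟨a, b⟩ h
    simp at h ⊢
    omega
  · intro a h
    simp at h ⊢
    omega
  · rintro ⟨a, b⟩ h
    simp at h ⊢
    omega
  · intro a h
    simp at h ⊢
    omega

theorem sum_fejer (j B : ℕ) (hj : j ≤ B) (x : AddCircle (2 * π)) :
    ∑ k ∈ Finset.Ioo (-(B : ℤ)) B, ((j - k.natAbs : ℕ) : ℂ) * fourier k x =
      ((‖∑ l ∈ Finset.range j, fourier (l : ℤ) x‖ ^ 2 : ℝ) : ℂ) := by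
  rw [Complex.ofReal_pow, ← Complex.mul_conj', map_sum, Finset.sum_mul_sum, ← Finset.sum_product']
  rw [← Finset.sum_fiberwise_of_maps_to (t := Finset.Ioo (-(B : ℤ)) B)
    (g := fun x : ℕ × ℕ => (x.1 : ℤ) - x.2)]
  · refine Finset.sum_congr rfl fun k _ => ?_
    rw [← card_filter_sub_eq, ← nsmul_eq_mul, ← Finset.sum_const]
    refine Finset.sum_congr rfl fun l hl => ?_
    rw [← (Finset.mem_filter.1 hl).2, sub_eq_add_neg, fourier_add, fourier_neg]
  · intro l hl
    simp at hl ⊢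
    omega

theorem integral_norm_sum_dyadCoeff_le {r : ℝ} (hr : 0 ≤ r) (hr1 : r ≤ 1) {s M : ℕ} (hM : s + 1 ≤ M) :
    ∫ x : AddCircle (2 * π), ‖∑ k ∈ Finset.Ioo (-(2 ^ M : ℤ)) (2 ^ M),
      (dyadCoeff r s k : ℂ) * fourier k x‖ ≤ 2 * π * (4 * (2 : ℝ) ^ (-(r * s))) := by
  have hB : ∀ j ∈ Finset.Ico (2 ^ s) (2 ^ (s + 1)), j ≤ 2 ^ M := fun j hj => by
    have := Nat.pow_le_pow_right (n := 2) (by norm_num) hM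
    simp at hj; omega
  have hInt : ∀ j : ℕ, ∫ x : AddCircle (2 * π), ‖∑ l ∈ Finset.range j, fourier (l : ℤ) x‖ ^ 2 =
      2 * π * j := fun j => by
    rcases Nat.eq_zero_or_pos j with rfl | hj
    · simp
    have h : ((∫ x : AddCircle (2 * π), ‖∑ l ∈ Finset.range j, fourier (l : ℤ) x‖ ^ 2 : ℝ) : ℂ) =
        ((2 * π * j : ℝ) : ℂ) := by
      rw [← integral_complex_ofReal]
      simp_rw [← sum_fejer j j le_rfl]
      rw [integral_finsetSum]
      · simp_rw [integral_const_mul, integral_fourier_eq]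
        rw [Finset.sum_eq_single 0]
        · simp; ring
        · intro b _ hb; simp [hb]
        · intro h; simp at h; omega
      · intro i _
        exact (Continuous.integrable_of_hasCompactSupport (by fun_prop)
          (HasCompactSupport.of_compactSpace _))
    exact_mod_cast h
  have hpt : ∀ x : AddCircle (2 * π), ‖∑ k ∈ Finset.Ioo (-(2 ^ M : ℤ)) (2 ^ M),
      (dyadCoeff r s k : ℂ) * fourier k x‖ ≤ ∑ j ∈ Finset.Ico (2 ^ s) (2 ^ (s + 1)),
        |bernDiff r j| * ‖∑ l ∈ Finset.range j, fourier (l : ℤ) x‖ ^ 2 := fun x => by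
    have h1 : ∑ k ∈ Finset.Ioo (-(2 ^ M : ℤ)) (2 ^ M), (dyadCoeff r s k : ℂ) * fourier k x =
        ∑ j ∈ Finset.Ico (2 ^ s) (2 ^ (s + 1)), (bernDiff r j : ℂ) *
          ((‖∑ l ∈ Finset.range j, fourier (l : ℤ) x‖ ^ 2 : ℝ) : ℂ) := by
      simp only [dyadCoeff]
      push_cast
      simp_rw [Finset.sum_mul]
      rw [Finset.sum_comm]
      refine Finset.sum_congr rfl fun j hj => ?_
      have := sum_fejer j (2 ^ M) (hB j hj) x
      push_cast at this
      rw [← this, Finset.mul_sum]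
      refine Finset.sum_congr rfl fun k _ => ?_
      ring
    rw [h1]
    refine (norm_sum_le _ _).trans (Finset.sum_le_sum fun j _ => ?_)
    rw [norm_mul, Complex.norm_real, Complex.norm_real, Real.norm_eq_abs, norm_pow, norm_norm]
  have hcont : ∀ f : AddCircle (2 * π) → ℝ, Continuous f → Integrable f := fun f hf =>
    hf.integrable_of_hasCompactSupport (HasCompactSupport.of_compactSpace _)
  refine (integral_mono (hcont _ (by fun_prop)) (hcont _ (by fun_prop)) hpt).trans ?_
  rw [integral_finsetSum _ fun j _ => hcont _ (by fun_prop)]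
  simp_rw [integral_const_mul, hInt]
  refine le_trans (le_of_eq ?_) (mul_le_mul_of_nonneg_left (sum_abs_bernDiff_le hr hr1 s)
    (by positivity))
  rw [Finset.mul_sum]
  exact Finset.sum_congr rfl fun j _ => by ring

theorem trigChar_apply {d : ℕ} (k : Fin d → ℤ) (x : Torus d) :
    trigChar k x = ∏ j, fourier (k j) (x j) := rfl

theorem trigChar_zero {d : ℕ} (x : Torus d) : trigChar (0 : Fin d → ℤ) x = 1 := by
  simp [trigChar_apply]

theorem trigChar_neg {d : ℕ} (k : Fin d → ℤ) (x : Torus d) :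
    trigChar (-k) x = conj (trigChar k x) := by
  simp only [trigChar_apply, Pi.neg_apply, fourier_neg, map_prod]

theorem trigChar_add {d : ℕ} (k l : Fin d → ℤ) (x : Torus d) :
    trigChar (k + l) x = trigChar k x * trigChar l x := by
  simp only [trigChar_apply, Pi.add_apply, fourier_add, Finset.prod_mul_distrib]

theorem norm_trigChar {d : ℕ} (k : Fin d → ℤ) (x : Torus d) : ‖trigChar k x‖ = 1 := by
  rw [trigChar_apply, norm_prod]
  exact Finset.prod_eq_one fun j _ => Circle.norm_coe _

theorem trigChar_sub {d : ℕ} (k : Fin d → ℤ) (x y : Torus d) :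
    trigChar k (x - y) = trigChar k x * conj (trigChar k y) := by
  simp only [trigChar_apply, map_prod, ← Finset.prod_mul_distrib]
  refine Finset.prod_congr rfl fun j _ => ?_
  rw [← fourier_neg, fourier_apply, fourier_apply, fourier_apply, Pi.sub_apply, zsmul_sub,
    sub_eq_add_neg, AddCircle.toCircle_add, Circle.coe_mul, neg_smul]

theorem integral_trigChar {d : ℕ} (k : Fin d → ℤ) :
    ∫ x : Torus d, trigChar k x = if k = 0 then (((2 * π) ^ d : ℝ) : ℂ) else 0 := by
  simp only [trigChar_apply]
  rw [MeasureTheory.integral_fintype_prod_volume_eq_prod (fun j => fun y => fourier (k j) y)]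
  simp only [integral_fourier_eq]
  split_ifs with h
  · subst h; simp
  · obtain ⟨i, hi⟩ := Function.ne_iff.mp h
    exact Finset.prod_eq_zero (Finset.mem_univ i) (if_neg hi)

theorem Continuous.integrable_torus {d : ℕ} {E : Type} [NormedAddCommGroup E] {f : Torus d → E}
    (hf : Continuous f) : Integrable f :=
  hf.integrable_of_hasCompactSupport (HasCompactSupport.of_compactSpace _)

theorem volume_real_torus (d : ℕ) : (volume : Measure (Torus d)).real Set.univ = (2 * π) ^ d := by
  have h := integral_trigChar (0 : Fin d → ℤ)
  simp only [trigChar_zero, integral_const, if_true] at h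
  rw [Complex.real_smul, mul_one] at h
  exact_mod_cast h

/-- Orthogonality of the trigonometric characters. -/
theorem integral_conj_trigChar_mul {d : ℕ} (k l : Fin d → ℤ) :
    ∫ x : Torus d, conj (trigChar k x) * trigChar l x =
      if k = l then (((2 * π) ^ d : ℝ) : ℂ) else 0 := by
  simp_rw [← trigChar_neg, ← trigChar_add, integral_trigChar]
  congr 1
  rw [eq_iff_iff, neg_add_eq_zero]

/-- Parseval's identity for trigonometric polynomials. -/
theorem integral_norm_sq_trigPoly {d : ℕ} (S : Finset (Fin d → ℤ)) (c : (Fin d → ℤ) → ℂ) :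
    ∫ x : Torus d, ‖∑ k ∈ S, c k * trigChar k x‖ ^ 2 = (2 * π) ^ d * ∑ k ∈ S, ‖c k‖ ^ 2 := by
  have h : ((∫ x : Torus d, ‖∑ k ∈ S, c k * trigChar k x‖ ^ 2 : ℝ) : ℂ) =
      (((2 * π) ^ d * ∑ k ∈ S, ‖c k‖ ^ 2 : ℝ) : ℂ) := by
    rw [← integral_complex_ofReal]
    have h1 : ∀ x : Torus d, ((‖∑ k ∈ S, c k * trigChar k x‖ ^ 2 : ℝ) : ℂ) =
        ∑ k ∈ S, ∑ l ∈ S, (conj (c k) * c l) * (conj (trigChar k x) * trigChar l x) := fun x => by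
      rw [Complex.ofReal_pow, ← Complex.conj_mul', map_sum, Finset.sum_mul_sum]
      refine Finset.sum_congr rfl fun k _ => Finset.sum_congr rfl fun l _ => ?_
      rw [map_mul]; ring
    simp_rw [h1]
    rw [integral_finsetSum _ fun k _ => (Continuous.integrable_torus (by fun_prop))]
    push_cast
    rw [Finset.mul_sum]
    refine Finset.sum_congr rfl fun k hk => ?_
    rw [integral_finsetSum _ fun k _ => (Continuous.integrable_torus (by fun_prop))]
    simp_rw [integral_const_mul, integral_conj_trigChar_mul]
    simp only [mul_ite, mul_zero, Finset.sum_ite_eq, hk, if_true]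
    rw [Complex.conj_mul']
    push_cast
    ring
  exact_mod_cast h

/-- The linear span of the trigonometric characters is dense in `C(Torus d, ℂ)`. -/
theorem span_trigChar_closure_eq_top (d : ℕ) :
    (Submodule.span ℂ (Set.range (trigChar (d := d)))).topologicalClosure = ⊤ := by
  let A : StarSubalgebra ℂ C(Torus d, ℂ) :=
    { toSubalgebra := Algebra.adjoin ℂ (Set.range trigChar)
      star_mem' := by
        change Algebra.adjoin ℂ (Set.range trigChar) ≤ star (Algebra.adjoin ℂ (Set.range trigChar))
        refine Algebra.adjoin_le ?_
        rintro _ ⟨n, rfl⟩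
        refine Algebra.subset_adjoin ⟨-n, ?_⟩
        ext1 x
        simp only [trigChar_neg, starRingEnd_apply, ContinuousMap.star_apply] }
  have hA : A.toSubalgebra.toSubmodule = Submodule.span ℂ (Set.range (trigChar (d := d))) := by
    apply Algebra.adjoin_eq_span_of_subset
    refine .trans (fun x ↦ Submonoid.closure_induction (fun _ ↦ id) ⟨0, ?_⟩ ?_)
      Submodule.subset_span
    · ext z
      simp [trigChar_zero]
    · rintro _ _ _ _ ⟨m, rfl⟩ ⟨n, rfl⟩
      refine ⟨m + n, ?_⟩
      ext z
      simp only [trigChar_add, ContinuousMap.mul_apply]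
  have hsep : A.SeparatesPoints := by
    intro x y hxy
    rw [Ne, funext_iff, not_forall] at hxy
    obtain ⟨i, hi⟩ := hxy
    refine ⟨_, ⟨trigChar (Pi.single i 1), Algebra.subset_adjoin ⟨Pi.single i 1, rfl⟩, rfl⟩, ?_⟩
    have hs : ∀ z : Torus d, trigChar (Pi.single i 1) z = fourier 1 (z i) := fun z => by
      rw [trigChar_apply, Finset.prod_eq_single i]
      · simp
      · intro j _ hj; simp [hj]
      · simp
    dsimp only
    rw [hs, hs, fourier_one, fourier_one]
    exact fun h => hi (AddCircle.injective_toCircle Real.two_pi_pos.ne' (Subtype.ext h))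
  rw [← hA]
  exact congr_arg (Subalgebra.toSubmodule <| StarSubalgebra.toSubalgebra ·)
    (ContinuousMap.starSubalgebra_topologicalClosure_eq_top_of_separatesPoints A hsep)

/-- A square integrable function on the torus with vanishing Fourier coefficients vanishes a.e. -/
theorem ae_eq_zero_of_integral_conj_trigChar_mul {d : ℕ} {h : Torus d → ℂ} (hh : MemLp h 2)
    (h0 : ∀ k, ∫ x : Torus d, conj (trigChar k x) * h x = 0) : h =ᵐ[volume] 0 := by
  set T := ContinuousMap.toLp (E := ℂ) 2 (volume : Measure (Torus d)) ℂ with hT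
  have htop : (Submodule.span ℂ (Set.range fun k : Fin d → ℤ => T (trigChar k))).topologicalClosure
      = ⊤ := by
    simpa only [Submodule.map_span, ContinuousLinearMap.coe_coe, ← Set.range_comp,
      Function.comp_def] using
      (ContinuousMap.toLp_denseRange ℂ (volume : Measure (Torus d)) ℂ
        (by norm_num : (2 : ℝ≥0∞) ≠ ∞)).topologicalClosure_map_submodule
        (span_trigChar_closure_eq_top d)
  rw [Submodule.topologicalClosure_eq_top_iff] at htop
  have hmem : hh.toLp h ∈ (Submodule.span ℂ (Set.range fun k : Fin d → ℤ => T (trigChar k)))ᗮ := by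
    rw [Submodule.mem_orthogonal]
    intro u hu
    induction hu using Submodule.span_induction with
    | mem u hu =>
      obtain ⟨k, rfl⟩ := hu
      rw [L2.inner_def, ← h0 k]
      refine integral_congr_ae ?_
      filter_upwards [hh.coeFn_toLp, ContinuousMap.coeFn_toLp (p := 2) (𝕜 := ℂ) volume (trigChar k)]
        with x h1 h2
      rw [h1, h2, RCLike.inner_apply', starRingEnd_apply]
    | zero => simp
    | add u v _ _ hu hv => rw [inner_add_left, hu, hv, add_zero]
    | smul a u _ hu => rw [inner_smul_left, hu, mul_zero]
  rw [htop, Submodule.mem_bot] at hmem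
  have h1 := hh.coeFn_toLp
  rw [hmem] at h1
  exact h1.symm.trans (Lp.coeFn_zero ℂ 2 volume)

/-- The frequencies `k` with `|k_i| < 2^M` for all `i`. -/
def freqBox (d M : ℕ) : Finset (Fin d → ℤ) :=
  Fintype.piFinset fun _ => Finset.Ioo (-(2 ^ M : ℤ)) (2 ^ M)

/-- Tensor products of the univariate blocks `dyadCoeff`. -/
def blockCoeff {d : ℕ} (r : ℝ) (s : Fin d → ℕ) (k : Fin d → ℤ) : ℝ :=
  ∏ i, dyadCoeff r (s i) (k i)

/-- Coefficients of the `n`-th hyperbolic layer of the Bernoulli kernel. -/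
def layerCoeff {d : ℕ} (r : ℝ) (n : ℕ) (k : Fin d → ℤ) : ℝ :=
  ∑ s ∈ Finset.piAntidiag (Finset.univ : Finset (Fin d)) n, blockCoeff r s k

theorem prod_two_rpow {d : ℕ} (a : ℝ) (s : Fin d → ℕ) :
    ∏ i, (2 : ℝ) ^ (-(a * s i)) = (2 : ℝ) ^ (-(a * (∑ i, s i : ℕ))) := by
  rw [← Real.rpow_sum_of_pos (by norm_num), Finset.sum_neg_distrib, ← Finset.mul_sum]
  push_cast
  rfl

theorem blockCoeff_eq_zero {d : ℕ} (r : ℝ) {s : Fin d → ℕ} {k : Fin d → ℤ} {M : ℕ}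
    (hs : ∀ i, s i + 1 ≤ M) (hk : k ∉ freqBox d M) : blockCoeff r s k = 0 := by
  simp only [freqBox, Fintype.mem_piFinset, not_forall, Finset.mem_Ioo] at hk
  obtain ⟨i, hi⟩ := hk
  refine Finset.prod_eq_zero (Finset.mem_univ i) (dyadCoeff_eq_zero r ?_)
  have h1 := Nat.pow_le_pow_right (n := 2) (by norm_num) (hs i)
  have h2 : ((2 ^ M : ℕ) : ℤ) = 2 ^ M := by push_cast; rfl
  omega

theorem integral_norm_sum_blockCoeff_le {d : ℕ} {r : ℝ} (hr : 0 ≤ r) (hr1 : r ≤ 1) {s : Fin d → ℕ}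
    {M : ℕ} (hs : ∀ i, s i + 1 ≤ M) :
    ∫ x : Torus d, ‖∑ k ∈ freqBox d M, (blockCoeff r s k : ℂ) * trigChar k x‖ ≤
      (2 * π) ^ d * (4 ^ d * (2 : ℝ) ^ (-(r * (∑ i, s i : ℕ)))) := by
  have h1 : ∀ x : Torus d, ‖∑ k ∈ freqBox d M, (blockCoeff r s k : ℂ) * trigChar k x‖ =
      ∏ i, ‖∑ k ∈ Finset.Ioo (-(2 ^ M : ℤ)) (2 ^ M), (dyadCoeff r (s i) k : ℂ) *
        fourier k (x i)‖ := fun x => by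
    rw [← norm_prod, Finset.prod_univ_sum, freqBox]
    congr 1
    refine Finset.sum_congr rfl fun k _ => ?_
    rw [blockCoeff, trigChar_apply, Finset.prod_mul_distrib]
    push_cast
    rfl
  simp_rw [h1]
  rw [MeasureTheory.integral_fintype_prod_volume_eq_prod (fun i => fun y : AddCircle (2 * π) =>
    ‖∑ k ∈ Finset.Ioo (-(2 ^ M : ℤ)) (2 ^ M), (dyadCoeff r (s i) k : ℂ) * fourier k y‖)]
  refine (Finset.prod_le_prod (fun i _ => integral_nonneg fun x => norm_nonneg _)
    fun i _ => integral_norm_sum_dyadCoeff_le hr hr1 (hs i)).trans (le_of_eq ?_)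
  simp only [Finset.prod_mul_distrib]
  rw [prod_two_rpow]
  simp [mul_pow]

theorem sum_dyadCoeff_mul_le {r : ℝ} (hr : 0 ≤ r) (hr1 : r ≤ 1) (a b M : ℕ) :
    |∑ k ∈ Finset.Ioo (-(2 ^ M : ℤ)) (2 ^ M), dyadCoeff r a k * dyadCoeff r b k| ≤
      64 * 2 ^ min a b * ((2 : ℝ) ^ (-(r * a)) * (2 : ℝ) ^ (-(r * b))) := by
  set S := Finset.Ioo (-(2 ^ (min a b + 1) : ℤ)) (2 ^ (min a b + 1)) with hS
  have hcard : (S.card : ℝ) ≤ 4 * 2 ^ min a b := by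
    rw [hS, Int.card_Ioo]
    have : ((2 ^ (min a b + 1) - -2 ^ (min a b + 1) - 1 : ℤ).toNat) ≤ 4 * 2 ^ min a b := by
      have h2 : (2 : ℤ) ^ (min a b + 1) = 2 * ((2 ^ min a b : ℕ) : ℤ) := by push_cast; ring
      rw [h2]; omega
    exact_mod_cast this
  have hz : ∀ k ∉ S, dyadCoeff r a k * dyadCoeff r b k = 0 := fun k hk => by
    have h2 : (2 : ℤ) ^ (min a b + 1) = ((2 ^ (min a b + 1) : ℕ) : ℤ) := by push_cast; ring
    simp only [hS, Finset.mem_Ioo, h2] at hk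
    rcases le_total a b with h | h
    · rw [min_eq_left h] at hk
      rw [dyadCoeff_eq_zero r (by omega), zero_mul]
    · rw [min_eq_right h] at hk
      rw [dyadCoeff_eq_zero r (s := b) (by omega), mul_zero]
  have hb : ∀ k, |dyadCoeff r a k * dyadCoeff r b k| ≤
      16 * ((2 : ℝ) ^ (-(r * a)) * (2 : ℝ) ^ (-(r * b))) := fun k => by
    rw [abs_mul]
    refine (mul_le_mul (abs_dyadCoeff_le hr hr1 a k) (abs_dyadCoeff_le hr hr1 b k)
      (abs_nonneg _) (by positivity)).trans (le_of_eq (by ring))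
  calc |∑ k ∈ Finset.Ioo (-(2 ^ M : ℤ)) (2 ^ M), dyadCoeff r a k * dyadCoeff r b k|
      ≤ ∑ k ∈ Finset.Ioo (-(2 ^ M : ℤ)) (2 ^ M), |dyadCoeff r a k * dyadCoeff r b k| :=
        Finset.abs_sum_le_sum_abs _ _
    _ ≤ ∑ k ∈ S, |dyadCoeff r a k * dyadCoeff r b k| := by
        rw [← Finset.sum_filter_add_sum_filter_not (Finset.Ioo (-(2 ^ M : ℤ)) (2 ^ M)) (· ∈ S),
          Finset.sum_eq_zero (s := Finset.filter (· ∉ S) _), add_zero]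
        · exact Finset.sum_le_sum_of_subset_of_nonneg (fun k hk => (Finset.mem_filter.1 hk).2)
            fun _ _ _ => abs_nonneg _
        · intro k hk
          rw [hz k (Finset.mem_filter.1 hk).2, abs_zero]
    _ ≤ S.card * (16 * ((2 : ℝ) ^ (-(r * a)) * (2 : ℝ) ^ (-(r * b)))) := by
        rw [← nsmul_eq_mul]
        exact Finset.sum_le_card_nsmul _ _ _ fun k _ => hb k
    _ ≤ 4 * 2 ^ min a b * (16 * ((2 : ℝ) ^ (-(r * a)) * (2 : ℝ) ^ (-(r * b)))) := by gcongr
    _ = _ := by ring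

theorem sum_blockCoeff_mul_le {d : ℕ} {r : ℝ} (hr : 0 ≤ r) (hr1 : r ≤ 1) (s t : Fin d → ℕ) (M : ℕ) :
    |∑ k ∈ freqBox d M, blockCoeff r s k * blockCoeff r t k| ≤
      64 ^ d * (∏ i, (2 : ℝ) ^ min (s i) (t i)) *
        ((2 : ℝ) ^ (-(r * (∑ i, s i : ℕ))) * (2 : ℝ) ^ (-(r * (∑ i, t i : ℕ)))) := by
  simp only [blockCoeff, ← Finset.prod_mul_distrib, freqBox]
  rw [← Finset.prod_univ_sum (fun _ : Fin d => Finset.Ioo (-(2 ^ M : ℤ)) (2 ^ M))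
    (fun i k => dyadCoeff r (s i) k * dyadCoeff r (t i) k), Finset.abs_prod]
  refine (Finset.prod_le_prod (fun i _ => abs_nonneg _)
    fun i _ => sum_dyadCoeff_mul_le hr hr1 (s i) (t i) M).trans (le_of_eq ?_)
  rw [Finset.prod_mul_distrib, Finset.prod_mul_distrib, Finset.prod_mul_distrib, prod_two_rpow,
    prod_two_rpow]
  simp

theorem sum_blockCoeff_sq_le {d : ℕ} {r : ℝ} (hr : 0 ≤ r) (hr1 : r ≤ 1) (s : Fin d → ℕ) (M : ℕ) :
    ∑ k ∈ freqBox d M, blockCoeff r s k ^ 2 ≤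
      64 ^ d * (2 : ℝ) ^ (((1 - 2 * r) * (∑ i, s i : ℕ))) := by
  have h := (le_abs_self _).trans (sum_blockCoeff_mul_le hr hr1 s s M)
  simp only [min_self, ← sq] at h
  refine h.trans (le_of_eq ?_)
  rw [Finset.prod_pow_eq_pow_sum, mul_assoc, ← Real.rpow_natCast (2 : ℝ) (∑ i, s i),
    ← Real.rpow_natCast (_ ^ _) 2, ← Real.rpow_mul (by norm_num), ← Real.rpow_add (by norm_num)]
  congr 2
  push_cast
  ring

theorem sum_geom_dist_le (a N : ℕ) :
    ∑ t ∈ Finset.range N, (3 / 4 : ℝ) ^ ((a - t) + (t - a)) ≤ 8 := by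
  have hg : ∀ n : ℕ, ∑ i ∈ Finset.range n, (3 / 4 : ℝ) ^ i ≤ 4 := fun n => by
    rw [geom_sum_eq (by norm_num)]
    have : (0 : ℝ) ≤ (3 / 4) ^ n := by positivity
    rw [div_le_iff_of_neg (by norm_num)]
    linarith
  calc ∑ t ∈ Finset.range N, (3 / 4 : ℝ) ^ ((a - t) + (t - a))
      ≤ ∑ t ∈ Finset.range (a + 1 + N), (3 / 4 : ℝ) ^ ((a - t) + (t - a)) :=
        Finset.sum_le_sum_of_subset_of_nonneg (fun t ht => by simp at ht ⊢; omega)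
          fun _ _ _ => by positivity
    _ = ∑ t ∈ Finset.range (a + 1), (3 / 4 : ℝ) ^ t +
        ∑ t ∈ Finset.range N, (3 / 4 : ℝ) ^ (t + 1) := by
        rw [Finset.sum_range_add]
        congr 1
        · rw [← Finset.sum_range_reflect]
          refine Finset.sum_congr rfl fun t ht => ?_
          simp at ht
          congr 1; omega
        · refine Finset.sum_congr rfl fun t _ => ?_
          congr 1; omega
    _ ≤ 4 + 4 := by
        refine add_le_add (hg _) (le_trans (Finset.sum_le_sum fun t _ => ?_) (hg N))
        rw [pow_succ]
        have : (0 : ℝ) ≤ (3 / 4) ^ t := by positivity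
        linarith
    _ = 8 := by norm_num

theorem two_pow_min_le (a b : ℕ) :
    (2 : ℝ) ^ min a b ≤ 2 ^ ((1 / 2 : ℝ) * (a + b)) * (3 / 4) ^ ((a - b) + (b - a)) := by
  have key : ∀ a n : ℕ, (2 : ℝ) ^ a ≤ 2 ^ ((1 / 2 : ℝ) * (a + (a + n : ℕ))) * (3 / 4) ^ n := by
    intro a n
    have h1 : (2 : ℝ) ^ ((1 / 2 : ℝ) * (a + (a + n : ℕ))) = 2 ^ a * (2 ^ (1 / 2 : ℝ)) ^ n := by
      rw [← Real.rpow_natCast, ← Real.rpow_natCast, ← Real.rpow_mul (by norm_num),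
        ← Real.rpow_add (by norm_num)]
      congr 1; push_cast; ring
    have h2 : (4 / 3 : ℝ) ≤ 2 ^ (1 / 2 : ℝ) := by
      rw [← Real.sqrt_eq_rpow]
      exact Real.le_sqrt_of_sq_le (by norm_num)
    rw [h1, mul_assoc, ← mul_pow]
    have h3 : 1 ≤ ((2 : ℝ) ^ (1 / 2 : ℝ) * (3 / 4)) ^ n := one_le_pow₀ (by linarith)
    have h4 : (0 : ℝ) < 2 ^ a := by positivity
    nlinarith
  rcases le_total a b with h | h
  · obtain ⟨n, rfl⟩ := Nat.exists_eq_add_of_le h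
    rw [min_eq_left h, show a - (a + n) + (a + n - a) = n by omega]
    exact key a n
  · obtain ⟨n, rfl⟩ := Nat.exists_eq_add_of_le h
    rw [min_eq_right h, show b + n - b + (b - (b + n)) = n by omega, add_comm ((b + n : ℕ) : ℝ)]
    exact key b n

theorem card_piAntidiag_le {d : ℕ} (hd : 1 ≤ d) (n : ℕ) :
    (Finset.piAntidiag (Finset.univ : Finset (Fin d)) n).card ≤ (n + 1) ^ (d - 1) := by
  obtain ⟨e, rfl⟩ := Nat.exists_eq_add_of_le' hd
  have h : (Fintype.piFinset fun _ : Fin e => Finset.range (n + 1)).card = (n + 1) ^ e := by simp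
  rw [Nat.add_sub_cancel, ← h]
  refine Finset.card_le_card_of_injOn (fun s i => s i.castSucc) ?_ ?_
  · intro s hs
    simp only [Finset.mem_coe, Finset.mem_piAntidiag] at hs
    simp only [Finset.mem_coe, Fintype.mem_piFinset, Finset.mem_range]
    intro i
    have := Finset.single_le_sum (f := s) (fun _ _ => Nat.zero_le _) (Finset.mem_univ i.castSucc)
    have h1 : ∑ i, s i = n := hs.1
    omega
  · intro s hs t ht hst
    simp only [Finset.mem_coe, Finset.mem_piAntidiag, Fin.sum_univ_castSucc] at hs ht
    have h1 : ∀ i : Fin e, s i.castSucc = t i.castSucc := fun i => congrFun hst i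
    funext i
    induction i using Fin.lastCases with
    | last =>
      have := hs.1.trans ht.1.symm
      simp only [h1] at this
      omega
    | cast i => exact h1 i

theorem sum_layerCoeff_sq_le {d : ℕ} (hd : 1 ≤ d) {r : ℝ} (hr : 0 ≤ r) (hr1 : r ≤ 1) (n M : ℕ) :
    ∑ k ∈ freqBox d M, layerCoeff r n k ^ 2 ≤
      512 ^ d * ((n : ℝ) + 1) ^ (d - 1) * (2 : ℝ) ^ ((1 - 2 * r) * n) := by
  set P := Finset.piAntidiag (Finset.univ : Finset (Fin d)) n with hP
  have hsum : ∀ s ∈ P, ∑ i, s i = n := fun s hs => (Finset.mem_piAntidiag.1 hs).1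
  have hst : ∀ s ∈ P, ∀ t ∈ P, ∑ k ∈ freqBox d M, blockCoeff r s k * blockCoeff r t k ≤
      64 ^ d * (2 : ℝ) ^ ((1 - 2 * r) * n) *
        ∏ i, (3 / 4 : ℝ) ^ ((s i - t i) + (t i - s i)) := fun s hs t ht => by
    refine ((le_abs_self _).trans (sum_blockCoeff_mul_le hr hr1 s t M)).trans ?_
    rw [hsum s hs, hsum t ht]
    have h1 : ∏ i, (2 : ℝ) ^ min (s i) (t i) ≤
        2 ^ (n : ℝ) * ∏ i, (3 / 4 : ℝ) ^ ((s i - t i) + (t i - s i)) := by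
      refine (Finset.prod_le_prod (fun i _ => by positivity)
        fun i _ => two_pow_min_le (s i) (t i)).trans (le_of_eq ?_)
      rw [Finset.prod_mul_distrib]
      congr 1
      rw [← Real.rpow_sum_of_pos (by norm_num), ← Finset.mul_sum, Finset.sum_add_distrib,
        ← Nat.cast_sum, ← Nat.cast_sum, hsum s hs, hsum t ht]
      congr 1; ring
    have h2 : (2 : ℝ) ^ (n : ℝ) * ((2 : ℝ) ^ (-(r * n)) * (2 : ℝ) ^ (-(r * n))) =
        (2 : ℝ) ^ ((1 - 2 * r) * n) := by
      rw [← Real.rpow_add (by norm_num), ← Real.rpow_add (by norm_num)]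
      congr 1; ring
    rw [← h2]
    refine le_trans (mul_le_mul_of_nonneg_right (mul_le_mul_of_nonneg_left h1 (by positivity))
      (by positivity)) (le_of_eq (by ring))
  have hPsub : ∀ t ∈ P, t ∈ Fintype.piFinset fun _ : Fin d => Finset.range (n + 1) := by
    intro t ht
    rw [Fintype.mem_piFinset]
    intro i
    have := Finset.single_le_sum (f := t) (fun _ _ => Nat.zero_le _) (Finset.mem_univ i)
    rw [hsum t ht] at this
    simpa using Nat.lt_succ_of_le this
  have hgeom : ∀ s : Fin d → ℕ, ∑ t ∈ P, ∏ i, (3 / 4 : ℝ) ^ ((s i - t i) + (t i - s i)) ≤ 8 ^ d := by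
    intro s
    calc ∑ t ∈ P, ∏ i, (3 / 4 : ℝ) ^ ((s i - t i) + (t i - s i))
        ≤ ∑ t ∈ Fintype.piFinset fun _ : Fin d => Finset.range (n + 1),
            ∏ i, (3 / 4 : ℝ) ^ ((s i - t i) + (t i - s i)) :=
          Finset.sum_le_sum_of_subset_of_nonneg hPsub fun _ _ _ => by positivity
      _ = ∏ i, ∑ t ∈ Finset.range (n + 1), (3 / 4 : ℝ) ^ ((s i - t) + (t - s i)) :=
          (Finset.prod_univ_sum (fun _ : Fin d => Finset.range (n + 1))
            (fun i t => (3 / 4 : ℝ) ^ ((s i - t) + (t - s i)))).symm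
      _ ≤ ∏ _i : Fin d, (8 : ℝ) := Finset.prod_le_prod
          (fun i _ => Finset.sum_nonneg fun _ _ => by positivity)
          fun i _ => sum_geom_dist_le (s i) (n + 1)
      _ = 8 ^ d := by simp
  calc ∑ k ∈ freqBox d M, layerCoeff r n k ^ 2
      = ∑ s ∈ P, ∑ t ∈ P, ∑ k ∈ freqBox d M, blockCoeff r s k * blockCoeff r t k := by
        simp only [layerCoeff, sq, Finset.sum_mul_sum]
        rw [Finset.sum_comm]
        exact Finset.sum_congr rfl fun s _ => Finset.sum_comm
    _ ≤ ∑ s ∈ P, ∑ t ∈ P, 64 ^ d * (2 : ℝ) ^ ((1 - 2 * r) * n) *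
        ∏ i, (3 / 4 : ℝ) ^ ((s i - t i) + (t i - s i)) :=
        Finset.sum_le_sum fun s hs => Finset.sum_le_sum fun t ht => hst s hs t ht
    _ ≤ ∑ s ∈ P, 64 ^ d * (2 : ℝ) ^ ((1 - 2 * r) * n) * 8 ^ d := by
        refine Finset.sum_le_sum fun s _ => ?_
        rw [← Finset.mul_sum]
        exact mul_le_mul_of_nonneg_left (hgeom s) (by positivity)
    _ = P.card * (64 ^ d * (2 : ℝ) ^ ((1 - 2 * r) * n) * 8 ^ d) := by
        rw [Finset.sum_const, nsmul_eq_mul]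
    _ ≤ ((n : ℝ) + 1) ^ (d - 1) * (64 ^ d * (2 : ℝ) ^ ((1 - 2 * r) * n) * 8 ^ d) := by
        gcongr
        exact_mod_cast card_piAntidiag_le hd n
    _ = _ := by
        rw [show (512 : ℝ) = 64 * 8 by norm_num, mul_pow]; ring

theorem integral_norm_sum_layerCoeff_le {d : ℕ} (hd : 1 ≤ d) {r : ℝ} (hr : 0 ≤ r) (hr1 : r ≤ 1)
    {n M : ℕ} (hn : n + 1 ≤ M) :
    ∫ x : Torus d, ‖∑ k ∈ freqBox d M, (layerCoeff r n k : ℂ) * trigChar k x‖ ≤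
      (2 * π) ^ d * (4 ^ d * ((n : ℝ) + 1) ^ (d - 1) * (2 : ℝ) ^ (-(r * n))) := by
  set P := Finset.piAntidiag (Finset.univ : Finset (Fin d)) n with hP
  have hsum : ∀ s ∈ P, ∑ i, s i = n := fun s hs => (Finset.mem_piAntidiag.1 hs).1
  have hpt : ∀ x : Torus d, ‖∑ k ∈ freqBox d M, (layerCoeff r n k : ℂ) * trigChar k x‖ ≤
      ∑ s ∈ P, ‖∑ k ∈ freqBox d M, (blockCoeff r s k : ℂ) * trigChar k x‖ := fun x => by
    refine le_trans (le_of_eq ?_) (norm_sum_le _ _)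
    rw [Finset.sum_comm]
    congr 1
    refine Finset.sum_congr rfl fun k _ => ?_
    rw [layerCoeff, ← Finset.sum_mul]
    push_cast
    rfl
  refine (integral_mono (Continuous.integrable_torus (by fun_prop))
    (Continuous.integrable_torus (by fun_prop)) hpt).trans ?_
  rw [integral_finsetSum _ fun k _ => (Continuous.integrable_torus (by fun_prop))]
  calc ∑ s ∈ P, ∫ x : Torus d, ‖∑ k ∈ freqBox d M, (blockCoeff r s k : ℂ) * trigChar k x‖
      ≤ ∑ s ∈ P, (2 * π) ^ d * (4 ^ d * (2 : ℝ) ^ (-(r * n))) := by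
        refine Finset.sum_le_sum fun s hs => ?_
        have h := integral_norm_sum_blockCoeff_le hr hr1 (s := s) (M := M) fun i => by
          have := Finset.single_le_sum (f := s) (fun _ _ => Nat.zero_le _) (Finset.mem_univ i)
          rw [hsum s hs] at this
          omega
        rwa [hsum s hs] at h
    _ = P.card * ((2 * π) ^ d * (4 ^ d * (2 : ℝ) ^ (-(r * n)))) := by
        rw [Finset.sum_const, nsmul_eq_mul]
    _ ≤ ((n : ℝ) + 1) ^ (d - 1) * ((2 * π) ^ d * (4 ^ d * (2 : ℝ) ^ (-(r * n)))) := by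
        gcongr
        exact_mod_cast card_piAntidiag_le hd n
    _ = _ := by ring

theorem one_le_two_pi_pow (d : ℕ) : (1 : ℝ) ≤ (2 * π) ^ d :=
  one_le_pow₀ (by linarith [Real.pi_gt_three])

theorem integral_norm_sq_conj_trigPoly {d : ℕ} (S : Finset (Fin d → ℤ)) (c : (Fin d → ℤ) → ℂ) :
    ∫ x : Torus d, ‖∑ k ∈ S, c k * conj (trigChar k x)‖ ^ 2 =
      (2 * π) ^ d * ∑ k ∈ S, ‖c k‖ ^ 2 := by
  have h := integral_norm_sq_trigPoly S (fun k => conj (c k))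
  simp only [RCLike.norm_conj] at h
  rw [← h]
  congr 1
  funext x
  rw [← RCLike.norm_conj]
  simp only [map_sum, map_mul, RingHomCompTriple.comp_apply, RingHom.id_apply]

theorem integral_mul_le_sqrt_mul_sqrt {α : Type} [MeasurableSpace α] {μ : Measure α} {f g : α → ℝ}
    (hf0 : ∀ x, 0 ≤ f x) (hg0 : ∀ x, 0 ≤ g x) (hf : MemLp f 2 μ) (hg : MemLp g 2 μ) :
    ∫ x, f x * g x ∂μ ≤ √(∫ x, f x ^ 2 ∂μ) * √(∫ x, g x ^ 2 ∂μ) := by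
  have h := integral_mul_le_Lp_mul_Lq_of_nonneg (μ := μ) (f := f) (g := g)
    Real.HolderConjugate.two_two (Filter.Eventually.of_forall hf0) (Filter.Eventually.of_forall hg0)
    (by simpa using hf) (by simpa using hg)
  simpa [Real.sqrt_eq_rpow] using h

theorem Continuous.memLp_torus {d : ℕ} {E : Type} [NormedAddCommGroup E] {f : Torus d → E}
    (hf : Continuous f) (q : ℝ≥0∞) : MemLp f q :=
  hf.memLp_of_hasCompactSupport (HasCompactSupport.of_compactSpace _)

/-- The mean of `|g|` is at most the quadratic mean, for a trigonometric polynomial `g`. -/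
theorem mean_norm_le_sqrt {d : ℕ} (S : Finset (Fin d → ℤ)) (c : (Fin d → ℤ) → ℂ) :
    ((2 * π) ^ d)⁻¹ * ∫ x : Torus d, ‖∑ k ∈ S, c k * conj (trigChar k x)‖ ≤
      √(∑ k ∈ S, ‖c k‖ ^ 2) := by
  have h := integral_mul_le_sqrt_mul_sqrt (μ := (volume : Measure (Torus d))) (f := fun _ => 1)
    (g := fun x => ‖∑ k ∈ S, c k * conj (trigChar k x)‖) (fun _ => zero_le_one)
    (fun _ => norm_nonneg _) (continuous_const.memLp_torus _)
    (Continuous.memLp_torus (by fun_prop) _)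
  rw [integral_norm_sq_conj_trigPoly] at h
  simp only [one_mul, one_pow, integral_const, smul_eq_mul, mul_one, volume_real_torus] at h
  have h0 : (0 : ℝ) < (2 * π) ^ d := by positivity
  rw [Real.sqrt_mul h0.le, ← mul_assoc, Real.mul_self_sqrt h0.le] at h
  rwa [inv_mul_le_iff₀ h0]

theorem integral_norm_rpow_le {d : ℕ} {p : ℝ} (hp : 0 < p)
    (φ : Lp ℂ (ENNReal.ofReal p) (volume : Measure (Torus d))) (hφ : ‖φ‖ ≤ 2) :
    ∫ x : Torus d, ‖φ x‖ ^ p ≤ 2 ^ p := by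
  have h := (Lp.memLp φ).eLpNorm_eq_integral_rpow_norm (by simpa using hp) ENNReal.ofReal_ne_top
  rw [ENNReal.toReal_ofReal hp.le] at h
  have h0 : 0 ≤ ∫ x : Torus d, ‖φ x‖ ^ p := integral_nonneg fun x => by positivity
  rw [Lp.norm_def, h, ENNReal.toReal_ofReal (by positivity)] at hφ
  calc ∫ x : Torus d, ‖φ x‖ ^ p = ((∫ x : Torus d, ‖φ x‖ ^ p) ^ p⁻¹) ^ p := by
        rw [← Real.rpow_mul h0, inv_mul_cancel₀ hp.ne', Real.rpow_one]
    _ ≤ 2 ^ p := by gcongr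

theorem le_add_rpow_mul_rpow {p t y : ℝ} (hp : 2 < p) (ht : 0 < t) (hy : 0 ≤ y) :
    y ≤ t + t ^ (1 - p / 2) * y ^ (p / 2) := by
  rcases le_or_gt y t with h | h
  · have : 0 ≤ t ^ (1 - p / 2) * y ^ (p / 2) := by positivity
    linarith
  · have hy' : 0 < y := ht.trans h
    have h1 : y = y ^ (1 - p / 2) * y ^ (p / 2) := by
      rw [← Real.rpow_add hy']; simp
    have h2 : y ^ (1 - p / 2) ≤ t ^ (1 - p / 2) :=
      Real.rpow_le_rpow_of_nonpos ht h.le (by linarith)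
    have h3 : y ^ (1 - p / 2) * y ^ (p / 2) ≤ t ^ (1 - p / 2) * y ^ (p / 2) := by gcongr
    linarith

theorem integrable_Lp {d : ℕ} {q : ℝ≥0∞} (hq : 1 ≤ q)
    (φ : Lp ℂ q (volume : Measure (Torus d))) : Integrable φ :=
  (Lp.memLp φ).integrable hq

theorem sum_mul_fCoeff_eq {d : ℕ} {φ : Torus d → ℂ} (hφ : Integrable φ)
    (S : Finset (Fin d → ℤ)) (c : (Fin d → ℤ) → ℂ) :
    ∑ k ∈ S, c k * fCoeff φ k =
      ((2 * π) ^ d)⁻¹ • ∫ x : Torus d, φ x * ∑ k ∈ S, c k * conj (trigChar k x) := by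
  have hInt : ∀ k : Fin d → ℤ, Integrable fun x : Torus d => conj (trigChar k x) * φ x := fun k =>
    hφ.bdd_mul (c := 1) (Continuous.aestronglyMeasurable (by fun_prop))
      (Filter.Eventually.of_forall fun x => by rw [RCLike.norm_conj, norm_trigChar])
  have h1 : ∀ x : Torus d, φ x * ∑ k ∈ S, c k * conj (trigChar k x) =
      ∑ k ∈ S, c k * (conj (trigChar k x) * φ x) := fun x => by
    rw [Finset.mul_sum]
    exact Finset.sum_congr rfl fun k _ => by ring
  simp_rw [h1]
  rw [integral_finsetSum _ fun k _ => (hInt k).const_mul _, Finset.smul_sum]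
  refine Finset.sum_congr rfl fun k _ => ?_
  rw [integral_const_mul, fCoeff, mul_smul_comm]

/-- Interpolation between `L_1` and `L_2` bounds for a pairing with a function in `L_p`. -/
theorem norm_sum_mul_fCoeff_le {d : ℕ} {p : ℝ} (hp : 2 < p)
    (φ : Lp ℂ (ENNReal.ofReal p) (volume : Measure (Torus d))) (hφ : ‖φ‖ ≤ 2)
    (S : Finset (Fin d → ℤ)) (c : (Fin d → ℤ) → ℂ) {t : ℝ} (ht : 0 < t) :
    ‖∑ k ∈ S, c k * fCoeff φ k‖ ≤
      t * (((2 * π) ^ d)⁻¹ * ∫ x : Torus d, ‖∑ k ∈ S, c k * conj (trigChar k x)‖) +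
        2 ^ (p / 2) * t ^ (1 - p / 2) * √(∑ k ∈ S, ‖c k‖ ^ 2) := by
  have h0 : (0 : ℝ) < (2 * π) ^ d := by positivity
  have hp1 : 1 ≤ ENNReal.ofReal p := by
    rw [← ENNReal.ofReal_one]; exact ENNReal.ofReal_le_ofReal (by linarith)
  have hφi := integrable_Lp hp1 φ
  set G : Torus d → ℂ := fun x => ∑ k ∈ S, c k * conj (trigChar k x) with hG
  have hGc : Continuous G := by rw [hG]; fun_prop
  have hmem : MemLp (fun x => ‖φ x‖ ^ (p / 2)) 2 := by
    have h := (Lp.memLp φ).norm_rpow_div (ENNReal.ofReal (p / 2))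
    rw [ENNReal.toReal_ofReal (by linarith), ← ENNReal.ofReal_div_of_pos (by linarith)] at h
    convert h using 1
    rw [show p / (p / 2) = 2 by field_simp]
    simp
  have hGm : MemLp (fun x => ‖G x‖) 2 := Continuous.memLp_torus (by fun_prop) _
  have hcs := integral_mul_le_sqrt_mul_sqrt (fun x => by positivity) (fun x => norm_nonneg _)
    hmem hGm
  have hsq : ∀ x, (‖φ x‖ ^ (p / 2)) ^ 2 = ‖φ x‖ ^ p := fun x => by
    rw [← Real.rpow_natCast, ← Real.rpow_mul (norm_nonneg _)]
    congr 1; push_cast; ring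
  simp_rw [hsq] at hcs
  rw [integral_norm_sq_conj_trigPoly] at hcs
  have h2p : √(∫ x : Torus d, ‖φ x‖ ^ p) ≤ 2 ^ (p / 2) := by
    rw [show (2 : ℝ) ^ (p / 2) = √(2 ^ p) by
      rw [Real.sqrt_eq_rpow, ← Real.rpow_mul (by norm_num)]; congr 1; ring]
    exact Real.sqrt_le_sqrt (integral_norm_rpow_le (by linarith) φ hφ)
  have hprod : Integrable fun x => ‖φ x‖ ^ (p / 2) * ‖G x‖ := hmem.integrable_mul hGm
  have hb : ∫ x : Torus d, ‖φ x * G x‖ ≤ t * (∫ x, ‖G x‖) +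
      t ^ (1 - p / 2) * ∫ x, ‖φ x‖ ^ (p / 2) * ‖G x‖ := by
    have hGi : Integrable fun x => ‖G x‖ := Continuous.integrable_torus (by fun_prop)
    rw [← integral_const_mul, ← integral_const_mul, ← integral_add (hGi.const_mul _)
      (hprod.const_mul _)]
    refine integral_mono_of_nonneg (Filter.Eventually.of_forall fun x => norm_nonneg _)
      ((hGi.const_mul _).add (hprod.const_mul _)) (Filter.Eventually.of_forall fun x => ?_)
    have h3 := le_add_rpow_mul_rpow hp ht (norm_nonneg (φ x))
    simp only [norm_mul]
    calc ‖φ x‖ * ‖G x‖ ≤ (t + t ^ (1 - p / 2) * ‖φ x‖ ^ (p / 2)) * ‖G x‖ := by gcongr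
      _ = _ := by ring
  rw [sum_mul_fCoeff_eq hφi, norm_smul, norm_inv, Real.norm_of_nonneg h0.le]
  have hroot : ((2 * π) ^ d)⁻¹ * √((2 * π) ^ d) ≤ 1 := by
    rw [inv_mul_le_iff₀ h0, mul_one]
    exact Real.sqrt_le_self_iff.2 (Or.inr (one_le_two_pi_pow d))
  calc ((2 * π) ^ d)⁻¹ * ‖∫ x : Torus d, φ x * G x‖
      ≤ ((2 * π) ^ d)⁻¹ * (t * (∫ x, ‖G x‖) +
          t ^ (1 - p / 2) * (2 ^ (p / 2) * √((2 * π) ^ d * ∑ k ∈ S, ‖c k‖ ^ 2))) := by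
        gcongr
        refine (norm_integral_le_integral_norm _).trans (hb.trans ?_)
        gcongr
        refine hcs.trans ?_
        gcongr
    _ = t * (((2 * π) ^ d)⁻¹ * ∫ x, ‖G x‖) + (((2 * π) ^ d)⁻¹ * √((2 * π) ^ d)) *
          (2 ^ (p / 2) * t ^ (1 - p / 2) * √(∑ k ∈ S, ‖c k‖ ^ 2)) := by
        rw [Real.sqrt_mul h0.le]; ring
    _ ≤ t * (((2 * π) ^ d)⁻¹ * ∫ x, ‖G x‖) + 1 *
          (2 ^ (p / 2) * t ^ (1 - p / 2) * √(∑ k ∈ S, ‖c k‖ ^ 2)) := by gcongr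
    _ = _ := by rw [one_mul]

theorem freqBox_mono (d : ℕ) {M M' : ℕ} (h : M ≤ M') : freqBox d M ⊆ freqBox d M' := by
  have h1 : (2 : ℤ) ^ M ≤ 2 ^ M' := pow_le_pow_right₀ (by norm_num) h
  intro k hk
  simp only [freqBox, Fintype.mem_piFinset, Finset.mem_Ioo] at hk ⊢
  intro i
  have := hk i
  constructor <;> linarith

/-- The convolution of `φ` with the block of the Bernoulli kernel of index `s`. -/
def blockSum {d : ℕ} (r : ℝ) (φ : Torus d → ℂ) (s : Fin d → ℕ) : C(Torus d, ℂ) :=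
  ∑ k ∈ freqBox d (∑ i, s i + 1), ((blockCoeff r s k : ℂ) * fCoeff φ k) • trigChar k

theorem blockSum_apply {d : ℕ} (r : ℝ) (φ : Torus d → ℂ) (s : Fin d → ℕ) (x : Torus d) :
    blockSum r φ s x = ∑ k ∈ freqBox d (∑ i, s i + 1),
      ((blockCoeff r s k : ℂ) * trigChar k x) * fCoeff φ k := by
  simp only [blockSum, ContinuousMap.coe_sum, Finset.sum_apply, ContinuousMap.coe_smul,
    Pi.smul_apply, smul_eq_mul]
  exact Finset.sum_congr rfl fun k _ => by ring

theorem le_sum_index {d : ℕ} (s : Fin d → ℕ) (i : Fin d) : s i ≤ ∑ i, s i :=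
  Finset.single_le_sum (f := s) (fun _ _ => Nat.zero_le _) (Finset.mem_univ i)

theorem blockSum_apply_of_le {d : ℕ} (r : ℝ) (φ : Torus d → ℂ) {s : Fin d → ℕ} {M : ℕ}
    (hM : ∑ i, s i + 1 ≤ M) (x : Torus d) :
    blockSum r φ s x = ∑ k ∈ freqBox d M, ((blockCoeff r s k : ℂ) * trigChar k x) * fCoeff φ k := by
  rw [blockSum_apply]
  refine Finset.sum_subset (freqBox_mono d hM) fun k _ hk => ?_
  rw [blockCoeff_eq_zero r (fun i => Nat.succ_le_succ (le_sum_index s i)) hk]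
  simp

theorem integral_norm_sum_mul_conj_trigChar {d : ℕ} (S : Finset (Fin d → ℤ)) (c : (Fin d → ℤ) → ℝ)
    (x : Torus d) : ∫ y : Torus d, ‖∑ k ∈ S, (c k : ℂ) * trigChar k x * conj (trigChar k y)‖ =
      ∫ y : Torus d, ‖∑ k ∈ S, (c k : ℂ) * trigChar k y‖ := by
  rw [← integral_sub_right_eq_self (fun y : Torus d => ‖∑ k ∈ S, (c k : ℂ) * trigChar k y‖) x]
  congr 1
  funext y
  rw [← RCLike.norm_conj, map_sum]
  congr 1
  refine Finset.sum_congr rfl fun k _ => ?_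
  rw [trigChar_sub, map_mul, map_mul, Complex.conj_conj, Complex.conj_ofReal]
  ring

theorem norm_blockSum_le {d : ℕ} {p r : ℝ} (hp : 2 < p) (hr : 0 ≤ r) (hr1 : r ≤ 1)
    (φ : Lp ℂ (ENNReal.ofReal p) (volume : Measure (Torus d))) (hφ : ‖φ‖ ≤ 2) (s : Fin d → ℕ) :
    ‖blockSum r φ s‖ ≤ (4 ^ d + 2 ^ (p / 2) * 8 ^ d) * 2 ^ (-((r - 1 / p) * (∑ i, s i : ℕ))) := by
  rw [ContinuousMap.norm_le _ (by positivity)]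
  intro x
  set n := ∑ i, s i with hn
  rw [blockSum_apply]
  refine (norm_sum_mul_fCoeff_le hp φ hφ (freqBox d (n + 1))
    (fun k => (blockCoeff r s k : ℂ) * trigChar k x) (t := 2 ^ ((1 / p) * n)) (by positivity)).trans ?_
  have h0 : (0 : ℝ) < (2 * π) ^ d := by positivity
  have h1 : ((2 * π) ^ d)⁻¹ * ∫ y : Torus d, ‖∑ k ∈ freqBox d (n + 1),
      (blockCoeff r s k : ℂ) * trigChar k x * conj (trigChar k y)‖ ≤
      4 ^ d * (2 : ℝ) ^ (-(r * n)) := by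
    rw [inv_mul_le_iff₀ h0]
    have h2 := integral_norm_sum_blockCoeff_le hr hr1 (s := s) (M := n + 1)
      (fun i => Nat.succ_le_succ (le_sum_index s i))
    rwa [← integral_norm_sum_mul_conj_trigChar _ _ x] at h2
  have h3 : √(∑ k ∈ freqBox d (n + 1), ‖(blockCoeff r s k : ℂ) * trigChar k x‖ ^ 2) ≤
      8 ^ d * 2 ^ ((1 / 2 - r) * n) := by
    rw [Real.sqrt_le_left (by positivity)]
    simp only [norm_mul, norm_trigChar, mul_one, Complex.norm_real, Real.norm_eq_abs, sq_abs]
    refine (sum_blockCoeff_sq_le hr hr1 s (n + 1)).trans (le_of_eq ?_)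
    rw [mul_pow, ← pow_mul, mul_comm d 2, pow_mul, ← Real.rpow_natCast (2 ^ _) 2,
      ← Real.rpow_mul (by norm_num)]
    norm_num only
    congr 2
    rw [hn]
    push_cast
    ring
  have e1 : (2 : ℝ) ^ ((1 / p) * n) * (4 ^ d * (2 : ℝ) ^ (-(r * n))) =
      4 ^ d * 2 ^ (-((r - 1 / p) * n)) := by
    rw [mul_left_comm, ← Real.rpow_add (by norm_num)]
    congr 2; ring
  have e2 : 2 ^ (p / 2) * ((2 : ℝ) ^ ((1 / p) * n)) ^ (1 - p / 2) * (8 ^ d * 2 ^ ((1 / 2 - r) * n)) =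
      2 ^ (p / 2) * 8 ^ d * 2 ^ (-((r - 1 / p) * n)) := by
    rw [← Real.rpow_mul (by norm_num)]
    have : (2 : ℝ) ^ (-((r - 1 / p) * n)) =
        2 ^ (1 / p * n * (1 - p / 2)) * 2 ^ ((1 / 2 - r) * n) := by
      rw [← Real.rpow_add (by norm_num)]
      congr 1
      field_simp
      ring
    rw [this]; ring
  calc _ ≤ (2 : ℝ) ^ ((1 / p) * n) * (4 ^ d * (2 : ℝ) ^ (-(r * n))) +
        2 ^ (p / 2) * ((2 : ℝ) ^ ((1 / p) * n)) ^ (1 - p / 2) *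
          (8 ^ d * 2 ^ ((1 / 2 - r) * n)) := by gcongr
    _ = _ := by rw [e1, e2]; ring

theorem sum_rpow_index_le {d : ℕ} {κ : ℝ} (hκ : 0 < κ) (u : Finset (Fin d → ℕ)) :
    ∑ s ∈ u, (2 : ℝ) ^ (-(κ * (∑ i, s i : ℕ))) ≤ ((1 - 2 ^ (-κ))⁻¹) ^ d := by
  set N := u.sup (fun s => ∑ i, s i) with hN
  have hu : u ⊆ Fintype.piFinset fun _ : Fin d => Finset.range (N + 1) := by
    intro s hs
    rw [Fintype.mem_piFinset]
    intro i
    have h1 := Finset.le_sup (f := fun s : Fin d → ℕ => ∑ i, s i) hs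
    have h2 := le_sum_index s i
    rw [Finset.mem_range]
    exact Nat.lt_succ_of_le (h2.trans h1)
  have hq : (2 : ℝ) ^ (-κ) < 1 := Real.rpow_lt_one_of_one_lt_of_neg (by norm_num) (by linarith)
  calc ∑ s ∈ u, (2 : ℝ) ^ (-(κ * (∑ i, s i : ℕ)))
      ≤ ∑ s ∈ Fintype.piFinset fun _ : Fin d => Finset.range (N + 1),
          (2 : ℝ) ^ (-(κ * (∑ i, s i : ℕ))) :=
        Finset.sum_le_sum_of_subset_of_nonneg hu fun _ _ _ => by positivity
    _ = ∏ _i : Fin d, ∑ t ∈ Finset.range (N + 1), (2 : ℝ) ^ (-(κ * t)) := by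
        rw [Finset.prod_univ_sum]
        exact Finset.sum_congr rfl fun s _ => (prod_two_rpow κ s).symm
    _ ≤ ∏ _i : Fin d, (1 - 2 ^ (-κ))⁻¹ := by
        refine Finset.prod_le_prod (fun _ _ => Finset.sum_nonneg fun _ _ => by positivity)
          fun _ _ => ?_
        have h3 : ∀ t : ℕ, (2 : ℝ) ^ (-(κ * t)) = (2 ^ (-κ)) ^ t := fun t => by
          rw [← Real.rpow_natCast, ← Real.rpow_mul (by norm_num)]; congr 1; ring
        simp_rw [h3]
        rw [← tsum_geometric_of_lt_one (by positivity) hq]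
        exact (summable_geometric_of_lt_one (by positivity) hq).sum_le_tsum _
          fun _ _ => by positivity
    _ = _ := by simp

theorem summable_rpow_index {d : ℕ} {κ : ℝ} (hκ : 0 < κ) :
    Summable fun s : Fin d → ℕ => (2 : ℝ) ^ (-(κ * (∑ i, s i : ℕ))) :=
  summable_of_sum_le (fun _ => by positivity) (sum_rpow_index_le hκ)

/-- Indices of the blocks belonging to the first `N` layers. -/
def layerIndices (d N : ℕ) : Finset (Fin d → ℕ) :=
  (Fintype.piFinset fun _ : Fin d => Finset.range N).filter fun s => ∑ i, s i < N

theorem mem_layerIndices {d N : ℕ} {s : Fin d → ℕ} : s ∈ layerIndices d N ↔ ∑ i, s i < N := by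
  simp only [layerIndices, Finset.mem_filter, Fintype.mem_piFinset, Finset.mem_range,
    and_iff_right_iff_imp]
  exact fun h i => (le_sum_index s i).trans_lt h

theorem sum_blockSum_layerIndices {d : ℕ} (r : ℝ) (φ : Torus d → ℂ) (N : ℕ) (x : Torus d) :
    ∑ s ∈ layerIndices d N, blockSum r φ s x =
      ∑ n ∈ Finset.range N, ∑ k ∈ freqBox d N,
        ((layerCoeff r n k : ℂ) * trigChar k x) * fCoeff φ k := by
  rw [← Finset.sum_fiberwise_of_maps_to (s := layerIndices d N) (t := Finset.range N)
    (g := fun s => ∑ i, s i) fun s hs => Finset.mem_range.2 (mem_layerIndices.1 hs)]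
  refine Finset.sum_congr rfl fun n hn => ?_
  have h1 : (layerIndices d N).filter (fun s => ∑ i, s i = n) =
      Finset.piAntidiag (Finset.univ : Finset (Fin d)) n := by
    ext s
    rw [Finset.mem_filter, mem_layerIndices, Finset.mem_piAntidiag]
    rw [Finset.mem_range] at hn
    constructor
    · exact fun h => ⟨h.2, fun i _ => Finset.mem_univ i⟩
    · intro h
      have h2 : ∑ i, s i = n := h.1
      exact ⟨h2 ▸ hn, h2⟩
  rw [h1]
  have h2 : ∀ s ∈ Finset.piAntidiag (Finset.univ : Finset (Fin d)) n, blockSum r φ s x =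
      ∑ k ∈ freqBox d N, ((blockCoeff r s k : ℂ) * trigChar k x) * fCoeff φ k := fun s hs => by
    have h3 : ∑ i, s i = n := (Finset.mem_piAntidiag.1 hs).1
    exact blockSum_apply_of_le r φ (by rw [h3]; exact Finset.mem_range.1 hn) x
  rw [Finset.sum_congr rfl h2, Finset.sum_comm]
  refine Finset.sum_congr rfl fun k _ => ?_
  rw [layerCoeff]
  push_cast
  rw [Finset.sum_mul, Finset.sum_mul]

theorem tendsto_sum_blockCoeff {d : ℕ} {r : ℝ} (hr : 0 < r) (hr1 : r ≤ 1) (k : Fin d → ℤ) :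
    Filter.Tendsto (fun S => ∑ s ∈ Fintype.piFinset fun _ : Fin d => Finset.range S,
      blockCoeff r s k) Filter.atTop (nhds (wBern d r k)) := by
  have h1 : wBern d r k = ∏ i, bernCoeff r (k i).natAbs := by
    refine Finset.prod_congr rfl fun i _ => ?_
    simp only [bernCoeff, Int.natAbs_eq_zero, Nat.cast_natAbs, Int.cast_abs]
  rw [h1]
  refine (tendsto_finsetProd _ fun i _ => tendsto_sum_dyadCoeff hr hr1 (k i)).congr fun S => ?_
  rw [Finset.prod_univ_sum]
  rfl

theorem tendsto_piFinset_range (d : ℕ) : Filter.Tendsto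
    (fun S => Fintype.piFinset fun _ : Fin d => Finset.range S) Filter.atTop Filter.atTop := by
  refine Filter.tendsto_atTop_finset_of_monotone ?_ ?_
  · intro a b h
    exact Fintype.piFinset_subset _ _ fun _ => Finset.range_subset_range.2 h
  · intro s
    refine ⟨∑ i, s i + 1, ?_⟩
    rw [Fintype.mem_piFinset]
    exact fun i => Finset.mem_range.2 (Nat.lt_succ_of_le (le_sum_index s i))

/-- Fourier coefficients as a continuous functional on continuous functions. -/
def fCoeffCLM {d : ℕ} (k : Fin d → ℤ) : C(Torus d, ℂ) →L[ℂ] ℂ :=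
  LinearMap.mkContinuous
    { toFun := fun g => fCoeff g k
      map_add' := fun f g => by
        simp only [fCoeff, ContinuousMap.add_apply, mul_add]
        rw [integral_add (Continuous.integrable_torus (by fun_prop))
          (Continuous.integrable_torus (by fun_prop)), smul_add]
      map_smul' := fun a f => by
        simp only [fCoeff, ContinuousMap.smul_apply, smul_eq_mul, mul_left_comm _ a,
          integral_const_mul, RingHom.id_apply]
        rw [mul_smul_comm] }
    1 fun g => by
      have h0 : (0 : ℝ) < (2 * π) ^ d := by positivity
      simp only [LinearMap.coe_mk, AddHom.coe_mk, fCoeff, norm_smul, norm_inv, one_mul]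
      rw [Real.norm_of_nonneg h0.le, inv_mul_le_iff₀ h0]
      refine (norm_integral_le_of_norm_le_const (C := ‖g‖)
        (Filter.Eventually.of_forall fun x => ?_)).trans_eq (by rw [volume_real_torus, mul_comm (‖g‖)])
      rw [norm_mul, RCLike.norm_conj, norm_trigChar, one_mul]
      exact g.norm_coe_le_norm x

theorem fCoeffCLM_trigChar {d : ℕ} (k l : Fin d → ℤ) :
    fCoeffCLM k (trigChar l) = if k = l then 1 else 0 := by
  have h0 : ((2 * π) ^ d : ℝ) ≠ 0 := by positivity
  change fCoeff (trigChar l) k = _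
  rw [fCoeff, integral_conj_trigChar_mul]
  split_ifs
  · rw [Complex.real_smul, ← Complex.ofReal_mul, inv_mul_cancel₀ h0, Complex.ofReal_one]
  · rw [smul_zero]

theorem fCoeffCLM_blockSum {d : ℕ} (r : ℝ) (φ : Torus d → ℂ) (s : Fin d → ℕ) (k : Fin d → ℤ) :
    fCoeffCLM k (blockSum r φ s) = (blockCoeff r s k : ℂ) * fCoeff φ k := by
  simp only [blockSum, map_sum, map_smul, fCoeffCLM_trigChar, smul_eq_mul, mul_ite, mul_one,
    mul_zero, Finset.sum_ite_eq]
  split_ifs with h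
  · rfl
  · rw [blockCoeff_eq_zero r (fun i => Nat.succ_le_succ (le_sum_index s i)) h]
    simp

/-- Truncation of the hyperbolic layer expansion of a function in the Sobolev space. -/
theorem ae_norm_sub_sum_layerCoeff_le {d : ℕ} {p r : ℝ} (hp : 2 < p) (hrp : 1 / p < r) (hr1 : r ≤ 1) :
    ∃ C : ℝ, 0 < C ∧ ∀ (f : Lp ℂ ∞ (volume : Measure (Torus d)))
      (φ : Lp ℂ (ENNReal.ofReal p) (volume : Measure (Torus d))),
      WRel d r (ENNReal.ofReal p) f φ → ‖φ‖ ≤ 2 → ∀ N : ℕ, ∀ᵐ x : Torus d,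
        ‖f x - ∑ n ∈ Finset.range N, ∑ k ∈ freqBox d N,
          ((layerCoeff r n k : ℂ) * trigChar k x) * fCoeff φ k‖ ≤
            C * 2 ^ (-((r - 1 / p) / 2 * N)) := by
  set κ := (r - 1 / p) / 2 with hκ
  have hκ0 : 0 < κ := by rw [hκ]; linarith
  have hr : 0 < r := lt_trans (by positivity) hrp
  have hq : (2 : ℝ) ^ (-κ) < 1 := Real.rpow_lt_one_of_one_lt_of_neg (by norm_num) (by linarith)
  have hq' : 0 < (1 - (2 : ℝ) ^ (-κ))⁻¹ := inv_pos.2 (by linarith)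
  set A : ℝ := 4 ^ d + 2 ^ (p / 2) * 8 ^ d with hA
  have hA0 : 0 < A := by positivity
  refine ⟨A * ((1 - 2 ^ (-κ))⁻¹) ^ d, by positivity, fun f φ hW hφ N => ?_⟩
  have hnorm : ∀ s, ‖blockSum r φ s‖ ≤ A * 2 ^ (-((r - 1 / p) * (∑ i, s i : ℕ))) :=
    norm_blockSum_le hp hr.le hr1 φ hφ
  have hsum : Summable (blockSum r φ) :=
    Summable.of_norm_bounded ((summable_rpow_index (by linarith)).mul_left A) hnorm
  obtain ⟨g, hg⟩ := hsum
  have hgc : ∀ k, fCoeff g k = (wBern d r k : ℂ) * fCoeff φ k := fun k => by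
    have h1 := ((fCoeffCLM k).hasSum hg).comp (tendsto_piFinset_range d)
    have h2 := ((Complex.continuous_ofReal.tendsto _).comp (tendsto_sum_blockCoeff hr hr1 k)).mul_const
      (fCoeff φ k)
    refine tendsto_nhds_unique h1 (h2.congr fun S => ?_)
    simp only [Function.comp_apply, fCoeffCLM_blockSum]
    push_cast
    rw [Finset.sum_mul]
  have hfg : (f : Torus d → ℂ) =ᵐ[volume] g := by
    have hf2 : MemLp f 2 (volume : Measure (Torus d)) := (Lp.memLp f).mono_exponent le_top
    have hg2 : MemLp g 2 (volume : Measure (Torus d)) := g.continuous.memLp_torus 2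
    have hInt : ∀ {h : Torus d → ℂ}, MemLp h 2 → ∀ k : Fin d → ℤ,
        Integrable fun x : Torus d => conj (trigChar k x) * h x := fun hh k =>
      (hh.integrable (by norm_num)).bdd_mul (c := 1) (Continuous.aestronglyMeasurable (by fun_prop))
        (Filter.Eventually.of_forall fun x => by rw [RCLike.norm_conj, norm_trigChar])
    have h := ae_eq_zero_of_integral_conj_trigChar_mul (hf2.sub hg2) fun k => by
      have h0 : (((2 * π) ^ d : ℝ))⁻¹ ≠ 0 := by positivity
      simp only [Pi.sub_apply, mul_sub]
      rw [integral_sub (hInt hf2 k) (hInt hg2 k), sub_eq_zero]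
      have h1 := (hW k).trans (hgc k).symm
      exact smul_right_injective ℂ h0 h1
    filter_upwards [h] with x hx
    exact sub_eq_zero.1 hx
  have htail : ‖g - ∑ s ∈ layerIndices d N, blockSum r φ s‖ ≤
      A * ((1 - 2 ^ (-κ))⁻¹) ^ d * 2 ^ (-(κ * N)) := by
    refine le_of_tendsto (hg.sub_const _).norm ?_
    filter_upwards [Filter.eventually_ge_atTop (layerIndices d N)] with u hu
    rw [← Finset.sum_sdiff hu, add_sub_cancel_right]
    calc ‖∑ s ∈ u \ layerIndices d N, blockSum r φ s‖
        ≤ ∑ s ∈ u \ layerIndices d N, A * (2 ^ (-(κ * (∑ i, s i : ℕ))) * 2 ^ (-(κ * N))) := by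
          refine norm_sum_le_of_le _ fun s hs => (hnorm s).trans ?_
          rw [Finset.mem_sdiff, mem_layerIndices, not_lt] at hs
          have h1 : (N : ℝ) ≤ (∑ i, s i : ℕ) := by exact_mod_cast hs.2
          rw [← Real.rpow_add (by norm_num)]
          gcongr
          · norm_num
          · rw [show r - 1 / p = 2 * κ by rw [hκ]; ring]
            nlinarith
      _ = A * (∑ s ∈ u \ layerIndices d N, (2 : ℝ) ^ (-(κ * (∑ i, s i : ℕ)))) * 2 ^ (-(κ * N)) := by
          rw [← Finset.mul_sum, ← Finset.sum_mul, mul_assoc]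
      _ ≤ _ := by
          gcongr
          exact sum_rpow_index_le hκ0 _
  filter_upwards [hfg] with x hx
  rw [hx, ← sum_blockSum_layerIndices]
  refine le_trans (le_of_eq ?_) ((ContinuousMap.norm_coe_le_norm _ x).trans htail)
  simp

/-- Number of grid points per coordinate resolving trigonometric polynomials on `freqBox d N`. -/
def gridSize (d N : ℕ) : ℕ := d * 2 ^ ((N + 1) * d + N + 4)

/-- Equidistant grid on the torus. -/
def gridPoint {d N : ℕ} (j : Fin d → Fin (gridSize d N)) : Torus d :=
  fun i => ((2 * π * (j i : ℕ) / gridSize d N : ℝ) : AddCircle (2 * π))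

theorem gridSize_pos {d : ℕ} (hd : 1 ≤ d) (N : ℕ) : 0 < gridSize d N := by
  unfold gridSize; positivity

theorem exists_gridPoint_near {d : ℕ} (hd : 1 ≤ d) (N : ℕ) (x : Torus d) :
    ∃ (j : Fin d → Fin (gridSize d N)) (h : Fin d → ℝ),
      (∀ i, |h i| ≤ 2 * π / gridSize d N) ∧
        x - gridPoint j = fun i => ((h i : ℝ) : AddCircle (2 * π)) := by
  have hM : (0 : ℝ) < gridSize d N := by exact_mod_cast gridSize_pos hd N
  have hpi := Real.two_pi_pos
  have key : ∀ i, ∃ (j : Fin (gridSize d N)) (h : ℝ), |h| ≤ 2 * π / gridSize d N ∧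
      x i - ((2 * π * (j : ℕ) / gridSize d N : ℝ) : AddCircle (2 * π)) = (h : AddCircle (2 * π)) := by
    intro i
    obtain ⟨b, hb, hbx⟩ : ∃ b ∈ Set.Ico (0 : ℝ) (2 * π), (b : AddCircle (2 * π)) = x i := by
      refine ⟨AddCircle.equivIco (2 * π) 0 (x i), ?_, ?_⟩
      · simpa using (AddCircle.equivIco (2 * π) 0 (x i)).2
      · exact (AddCircle.equivIco (2 * π) 0).symm_apply_apply (x i)
    have h1 : 0 ≤ b * gridSize d N / (2 * π) := by
      have := hb.1
      positivity
    have h2 : b * gridSize d N / (2 * π) < gridSize d N := by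
      rw [div_lt_iff₀ hpi, mul_comm]
      exact mul_lt_mul_of_pos_left hb.2 hM
    have h3 : ⌊b * gridSize d N / (2 * π)⌋₊ < gridSize d N := (Nat.floor_lt h1).2 h2
    refine ⟨⟨_, h3⟩, b - 2 * π * ⌊b * gridSize d N / (2 * π)⌋₊ / gridSize d N, ?_, ?_⟩
    · have h4 := Nat.floor_le h1
      have h5 := Nat.lt_floor_add_one (b * gridSize d N / (2 * π))
      rw [le_div_iff₀ hpi] at h4
      rw [div_lt_iff₀ hpi] at h5
      rw [abs_le]
      constructor
      · have : 2 * π * ⌊b * gridSize d N / (2 * π)⌋₊ / gridSize d N ≤ b := by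
          rw [div_le_iff₀ hM]; linarith
        have : 0 ≤ 2 * π / gridSize d N := by positivity
        linarith
      · rw [sub_le_iff_le_add, ← add_div, le_div_iff₀ hM]
        linarith
    · rw [AddCircle.coe_sub, hbx]
  choose j h hh hx using key
  exact ⟨j, h, hh, funext hx⟩

theorem norm_trigChar_coe_sub_one_le {d : ℕ} (k : Fin d → ℤ) (h : Fin d → ℝ) :
    ‖trigChar k (fun i => ((h i : ℝ) : AddCircle (2 * π))) - 1‖ ≤ ∑ i, |(k i : ℝ)| * |h i| := by
  have h1 : trigChar k (fun i => ((h i : ℝ) : AddCircle (2 * π))) =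
      Complex.exp (Complex.I * ((∑ i, k i * h i : ℝ) : ℂ)) := by
    rw [trigChar_apply]
    push_cast
    rw [Finset.mul_sum, Complex.exp_sum]
    refine Finset.prod_congr rfl fun i _ => ?_
    rw [fourier_coe_apply]
    congr 1
    have : (π : ℂ) ≠ 0 := by exact_mod_cast Real.pi_ne_zero
    push_cast
    field_simp
  rw [h1]
  refine (Real.norm_exp_I_mul_ofReal_sub_one_le).trans ?_
  rw [Real.norm_eq_abs]
  refine (Finset.abs_sum_le_sum_abs _ _).trans (le_of_eq ?_)
  simp only [abs_mul]

theorem card_freqBox_le (d N : ℕ) : (freqBox d N).card ≤ 2 ^ ((N + 1) * d) := by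
  rw [freqBox, Fintype.card_piFinset]
  simp only [Int.card_Ioo, Finset.prod_const, Finset.card_univ, Fintype.card_fin]
  rw [pow_mul]
  refine Nat.pow_le_pow_left ?_ d
  rw [Int.toNat_le]
  push_cast
  rw [pow_succ]
  linarith

theorem norm_fCoeffCLM_apply_le {d : ℕ} (k : Fin d → ℤ) (g : C(Torus d, ℂ)) :
    ‖fCoeffCLM k g‖ ≤ ‖g‖ := by
  refine ((fCoeffCLM k).le_opNorm g).trans ?_
  exact mul_le_of_le_one_left (norm_nonneg _) (LinearMap.mkContinuous_norm_le _ zero_le_one _)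

/-- The uniform norm of a trigonometric polynomial is controlled by its values on a grid. -/
theorem norm_trigPoly_le_of_grid {d : ℕ} (hd : 1 ≤ d) (N : ℕ) (c : (Fin d → ℤ) → ℂ) {δ : ℝ}
    (h : ∀ j : Fin d → Fin (gridSize d N),
      ‖∑ k ∈ freqBox d N, c k * trigChar k (gridPoint j)‖ ≤ δ) (x : Torus d) :
    ‖∑ k ∈ freqBox d N, c k * trigChar k x‖ ≤ 2 * δ := by
  set F : C(Torus d, ℂ) := ∑ k ∈ freqBox d N, c k • trigChar k with hF
  have hFx : ∀ x, F x = ∑ k ∈ freqBox d N, c k * trigChar k x := fun x => by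
    simp only [hF, ContinuousMap.coe_sum, Finset.sum_apply, ContinuousMap.coe_smul,
      Pi.smul_apply, smul_eq_mul]
  have hc : ∀ k ∈ freqBox d N, ‖c k‖ ≤ ‖F‖ := fun k hk => by
    have h1 : fCoeffCLM k F = c k := by
      simp only [hF, map_sum, map_smul, fCoeffCLM_trigChar, smul_eq_mul, mul_ite, mul_one,
        mul_zero, Finset.sum_ite_eq, if_pos hk]
    rw [← h1]
    exact norm_fCoeffCLM_apply_le k F
  have hM : (0 : ℝ) < gridSize d N := by exact_mod_cast gridSize_pos hd N
  have hpi : 2 * π ≤ 8 := by linarith [Real.pi_le_four]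
  have hδ : 0 ≤ δ := (norm_nonneg _).trans (h fun _ => ⟨0, gridSize_pos hd N⟩)
  have hchar : ∀ k ∈ freqBox d N, ∀ x : Torus d, ∀ j : Fin d → Fin (gridSize d N), ∀ v : Fin d → ℝ,
      (∀ i, |v i| ≤ 2 * π / gridSize d N) →
      x - gridPoint j = (fun i => ((v i : ℝ) : AddCircle (2 * π))) →
      ‖trigChar k x - trigChar k (gridPoint j)‖ ≤ d * (2 ^ N * (8 / gridSize d N)) := by
    intro k hk x j v hv hx
    have h1 : trigChar k x - trigChar k (gridPoint j) =
        trigChar k (gridPoint j) * (trigChar k (x - gridPoint j) - 1) := by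
      rw [trigChar_sub, mul_sub, mul_one, mul_left_comm, Complex.mul_conj,
        Complex.normSq_eq_norm_sq, norm_trigChar]
      simp
    rw [h1, norm_mul, norm_trigChar, one_mul, hx]
    refine (norm_trigChar_coe_sub_one_le k v).trans ?_
    calc ∑ i, |(k i : ℝ)| * |v i| ≤ ∑ _i : Fin d, 2 ^ N * (8 / (gridSize d N : ℝ)) := by
          refine Finset.sum_le_sum fun i _ => ?_
          simp only [freqBox, Fintype.mem_piFinset, Finset.mem_Ioo] at hk
          refine mul_le_mul ?_ ((hv i).trans (by gcongr)) (abs_nonneg _) (by positivity)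
          rw [abs_le]
          constructor
          · exact_mod_cast (hk i).1.le
          · exact_mod_cast (hk i).2.le
      _ = _ := by simp
  have hlip : ∀ x, ‖F x‖ ≤ δ + ‖F‖ / 2 := fun x => by
    obtain ⟨j, v, hv, hx⟩ := exists_gridPoint_near hd N x
    have h1 : ‖F x - F (gridPoint j)‖ ≤ ‖F‖ / 2 := by
      rw [hFx, hFx, ← Finset.sum_sub_distrib]
      calc ‖∑ k ∈ freqBox d N, (c k * trigChar k x - c k * trigChar k (gridPoint j))‖
          ≤ ∑ _k ∈ freqBox d N, ‖F‖ * (d * (2 ^ N * (8 / gridSize d N))) := by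
            refine norm_sum_le_of_le _ fun k hk => ?_
            rw [← mul_sub, norm_mul]
            exact mul_le_mul (hc k hk) (hchar k hk x j v hv hx) (norm_nonneg _) (norm_nonneg _)
        _ ≤ 2 ^ ((N + 1) * d) * (‖F‖ * (d * (2 ^ N * (8 / gridSize d N)))) := by
            rw [Finset.sum_const, nsmul_eq_mul]
            gcongr
            exact_mod_cast card_freqBox_le d N
        _ = ‖F‖ / 2 := by
            have hd' : (d : ℝ) ≠ 0 := by positivity
            rw [gridSize]
            push_cast
            rw [pow_add, pow_add]
            field_simp
            norm_num
    have h2 := h j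
    rw [← hFx] at h2
    calc ‖F x‖ = ‖F (gridPoint j) + (F x - F (gridPoint j))‖ := by congr 1; ring
      _ ≤ _ := (norm_add_le _ _).trans (add_le_add h2 h1)
  have hn : ‖F‖ ≤ δ + ‖F‖ / 2 := (ContinuousMap.norm_le _ (by positivity)).2 hlip
  rw [← hFx]
  exact (F.norm_coe_le_norm x).trans (by linarith)

theorem log_card_grid_le {d : ℕ} (hd : 1 ≤ d) (N : ℕ) :
    Real.log (4 * Fintype.card (Fin d → Fin (gridSize d N))) + 1 ≤ 16 * d ^ 2 * (N + 1) := by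
  have hM : (0 : ℝ) < gridSize d N := by exact_mod_cast gridSize_pos hd N
  have hd1 : (1 : ℝ) ≤ d := by exact_mod_cast hd
  rw [Fintype.card_fun, Fintype.card_fin, Fintype.card_fin]
  push_cast
  rw [Real.log_mul (by norm_num) (by positivity), Real.log_pow, gridSize]
  push_cast
  rw [Real.log_mul (by positivity) (by positivity), Real.log_pow]
  have h2 : Real.log 2 ≤ 1 := by linarith [Real.log_two_lt_d9]
  have h20 : 0 ≤ Real.log 2 := Real.log_nonneg (by norm_num)
  have h4 : Real.log 4 ≤ 2 := by
    rw [show (4 : ℝ) = 2 ^ 2 by norm_num, Real.log_pow]; push_cast; linarith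
  have hld : Real.log d ≤ d := (Real.log_le_self (by positivity))
  have hN : (0 : ℝ) ≤ N := Nat.cast_nonneg N
  push_cast
  have h5 : (((N : ℝ) + 1) * d + N + 4) * Real.log 2 ≤ ((N : ℝ) + 1) * d + N + 4 :=
    mul_le_of_le_one_right (by positivity) h2
  have h6 : (d : ℝ) * (Real.log d + (((N : ℝ) + 1) * d + N + 4) * Real.log 2) ≤
      d * (d + (((N : ℝ) + 1) * d + N + 4)) := by gcongr
  have hdd : (d : ℝ) ≤ d ^ 2 := by nlinarith
  have h7 : (d : ℝ) * N ≤ d ^ 2 * N := by gcongr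
  nlinarith [mul_nonneg (sq_nonneg (d : ℝ)) hN]

/-- Truncated hyperbolic layer expansion. -/
def layerSum {d : ℕ} (r : ℝ) (N : ℕ) (φ : Torus d → ℂ) (x : Torus d) : ℂ :=
  ∑ n ∈ Finset.range N, ∑ k ∈ freqBox d N, ((layerCoeff r n k : ℂ) * trigChar k x) * fCoeff φ k

/-- Trigonometric polynomial with given coefficients on `freqBox d N`. -/
def trigPolyMap (d N : ℕ) : ((Fin d → ℤ) → ℂ) →ₗ[ℂ] C(Torus d, ℂ) where
  toFun c := ∑ k ∈ freqBox d N, c k • trigChar k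
  map_add' c c' := by simp only [Pi.add_apply, add_smul, Finset.sum_add_distrib]
  map_smul' a c := by simp only [Pi.smul_apply, smul_assoc, Finset.smul_sum, RingHom.id_apply]

theorem trigPolyMap_apply {d N : ℕ} (c : (Fin d → ℤ) → ℂ) (x : Torus d) :
    trigPolyMap d N c x = ∑ k ∈ freqBox d N, c k * trigChar k x := by
  simp only [trigPolyMap, LinearMap.coe_mk, AddHom.coe_mk, ContinuousMap.coe_sum, Finset.sum_apply,
    ContinuousMap.coe_smul, Pi.smul_apply, smul_eq_mul]

theorem trigChar_mem_range_trigPolyMap {d N : ℕ} {k : Fin d → ℤ} (hk : k ∈ freqBox d N) :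
    trigChar k ∈ LinearMap.range (trigPolyMap d N) := by
  refine ⟨Pi.single k 1, ?_⟩
  change ∑ l ∈ freqBox d N, (Pi.single k (1 : ℂ) : (Fin d → ℤ) → ℂ) l • trigChar l = _
  rw [Finset.sum_eq_single_of_mem k hk fun l _ hl => by rw [Pi.single_eq_of_ne hl, zero_smul],
    Pi.single_eq_same, one_smul]

theorem layerSum_eq {d : ℕ} (r : ℝ) (N : ℕ) (φ : Torus d → ℂ) (x : Torus d) :
    layerSum r N φ x = ∑ k ∈ freqBox d N,
      (∑ n ∈ Finset.range N, (layerCoeff r n k : ℂ) * fCoeff φ k) * trigChar k x := by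
  rw [layerSum, Finset.sum_comm]
  refine Finset.sum_congr rfl fun k _ => ?_
  rw [Finset.sum_mul]
  exact Finset.sum_congr rfl fun n _ => by ring

theorem mean_norm_sum_layerCoeff_le {d : ℕ} (hd : 1 ≤ d) {r : ℝ} (hr : 0 ≤ r) (hr1 : r ≤ 1)
    {n N : ℕ} (hn : n < N) {J : Type} [Fintype J] (y : J → Torus d) (μ : J → ℂ)
    (hμ : ∑ j, ‖μ j‖ ≤ 1) :
    ((2 * π) ^ d)⁻¹ * ∫ x : Torus d, ‖∑ k ∈ freqBox d N,
      ((layerCoeff r n k : ℂ) * ∑ j, μ j * trigChar k (y j)) * conj (trigChar k x)‖ ≤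
        4 ^ d * ((n : ℝ) + 1) ^ (d - 1) * (2 : ℝ) ^ (-(r * n)) := by
  have h0 : (0 : ℝ) < (2 * π) ^ d := by positivity
  rw [inv_mul_le_iff₀ h0]
  set A := (2 * π) ^ d * (4 ^ d * ((n : ℝ) + 1) ^ (d - 1) * (2 : ℝ) ^ (-(r * n))) with hA
  have hA0 : 0 ≤ A := by positivity
  have hpt : ∀ x : Torus d, ‖∑ k ∈ freqBox d N,
      ((layerCoeff r n k : ℂ) * ∑ j, μ j * trigChar k (y j)) * conj (trigChar k x)‖ ≤
      ∑ j, ‖μ j‖ * ‖∑ k ∈ freqBox d N,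
        (layerCoeff r n k : ℂ) * trigChar k (y j) * conj (trigChar k x)‖ := fun x => by
    simp_rw [← norm_mul]
    refine le_trans (le_of_eq ?_) (norm_sum_le _ _)
    congr 1
    simp_rw [Finset.mul_sum, Finset.sum_mul]
    rw [Finset.sum_comm]
    exact Finset.sum_congr rfl fun j _ => Finset.sum_congr rfl fun k _ => by ring
  calc _ ≤ ∫ x : Torus d, ∑ j, ‖μ j‖ * ‖∑ k ∈ freqBox d N,
        (layerCoeff r n k : ℂ) * trigChar k (y j) * conj (trigChar k x)‖ :=
        integral_mono (Continuous.integrable_torus (by fun_prop))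
          (Continuous.integrable_torus (by fun_prop)) hpt
    _ = ∑ j, ‖μ j‖ * ∫ x : Torus d, ‖∑ k ∈ freqBox d N,
          (layerCoeff r n k : ℂ) * trigChar k x‖ := by
        rw [integral_finsetSum _ fun j _ => Continuous.integrable_torus (by fun_prop)]
        refine Finset.sum_congr rfl fun j _ => ?_
        rw [integral_const_mul, integral_norm_sum_mul_conj_trigChar]
    _ ≤ ∑ j, ‖μ j‖ * A := by
        gcongr
        exact integral_norm_sum_layerCoeff_le hd hr hr1 hn
    _ ≤ A := by
        rw [← Finset.sum_mul]
        exact mul_le_of_le_one_left hA0 hμ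

/-- Approximation of the truncated layer expansion from a fixed space of dimension at most `m`,
reduced to a bound for functionals annihilating that space. -/
theorem exists_submodule_forall_layerSum_sub_le {d : ℕ} (hd : 1 ≤ d) {r : ℝ} (hr : 0 ≤ r)
    (hr1 : r ≤ 1) {m N : ℕ} (hm : 1 ≤ m) (σ : ℕ → ℝ) {R δ δ' : ℝ} (hR : 0 < R)
    (hσ : ∑ n ∈ Finset.range N, σ n ^ 2 * ∑ k ∈ freqBox d N, layerCoeff r n k ^ 2 ≤ R)
    (hδ : δ < δ') :
    ∃ L : Submodule ℂ C(Torus d, ℂ), FiniteDimensional ℂ L ∧ Module.finrank ℂ L ≤ m ∧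
      ∀ φ : Torus d → ℂ,
        (∀ c : ℕ → (Fin d → ℤ) → ℂ,
          (∀ n < N, ((2 * π) ^ d)⁻¹ * ∫ x : Torus d, ‖∑ k ∈ freqBox d N,
            c n k * conj (trigChar k x)‖ ≤
              4 ^ d * ((n : ℝ) + 1) ^ (d - 1) * (2 : ℝ) ^ (-(r * n))) →
          ∑ n ∈ Finset.range N, σ n ^ 2 * ∑ k ∈ freqBox d N, ‖c n k‖ ^ 2 ≤
            51200 * R * (16 * d ^ 2 * (N + 1)) / m →
          ‖∑ n ∈ Finset.range N, ∑ k ∈ freqBox d N, c n k * fCoeff φ k‖ ≤ δ) →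
        ∃ h ∈ L, ∀ x, ‖layerSum r N φ x - h x‖ ≤ 2 * δ' := by
  have : Nonempty (Fin (gridSize d N)) := ⟨⟨0, gridSize_pos hd N⟩⟩
  set I : Finset (ℕ × (Fin d → ℤ)) := Finset.range N ×ˢ freqBox d N with hI
  have hsumI : ∀ f : ℕ × (Fin d → ℤ) → ℝ, ∑ i : I, f i =
      ∑ n ∈ Finset.range N, ∑ k ∈ freqBox d N, f (n, k) := fun f => by
    rw [Finset.sum_coe_sort I f, hI, Finset.sum_product]
  obtain ⟨G, hG⟩ := exists_sign_matrix_kernel_bound (ι := I) (J := Fin d → Fin (gridSize d N)) hm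
    (fun j i => ((σ i.1.1 * layerCoeff r i.1.1 i.1.2 : ℝ) : ℂ) * trigChar i.1.2 (gridPoint j)) R hR
    fun j => by
      simp only [norm_mul, norm_trigChar, mul_one, Complex.norm_real, Real.norm_eq_abs, mul_pow,
        sq_abs]
      refine le_trans (le_of_eq ?_) hσ
      rw [hsumI fun i => σ i.1 ^ 2 * layerCoeff r i.1 i.2 ^ 2]
      simp_rw [Finset.mul_sum]
  set g : Fin m → C(Torus d, ℂ) := fun l => ∑ i : I,
    ((boolSign (G l i) : ℂ) * ((σ i.1.1 * layerCoeff r i.1.1 i.1.2 : ℝ) : ℂ)) •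
      trigChar i.1.2 with hg
  have hgx : ∀ l x, g l x = ∑ i : I, ((boolSign (G l i) : ℂ) *
      ((σ i.1.1 * layerCoeff r i.1.1 i.1.2 : ℝ) : ℂ)) * trigChar i.1.2 x := fun l x => by
    simp only [hg, ContinuousMap.coe_sum, Finset.sum_apply, ContinuousMap.coe_smul,
      Pi.smul_apply, smul_eq_mul]
  refine ⟨Submodule.span ℂ (Set.range g), FiniteDimensional.span_of_finite ℂ (Set.finite_range g),
    ?_, fun φ hφ => ?_⟩
  · exact (finrank_range_le_card g).trans_eq (Fintype.card_fin m)
  have hrange : Submodule.span ℂ (Set.range g) ≤ LinearMap.range (trigPolyMap d N) := by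
    rw [Submodule.span_le]
    rintro _ ⟨l, rfl⟩
    exact Submodule.sum_mem _ fun i _ => Submodule.smul_mem _ _
      (trigChar_mem_range_trigPolyMap (Finset.mem_product.1 i.2).2)
  let ev : C(Torus d, ℂ) →ₗ[ℂ] ((Fin d → Fin (gridSize d N)) → ℂ) :=
    { toFun := fun f j => f (gridPoint j)
      map_add' := fun f f' => rfl
      map_smul' := fun a f => rfl }
  obtain ⟨u, hu, huF⟩ := exists_mem_forall_norm_sub_le ((Submodule.span ℂ (Set.range g)).map ev)
    (fun j => layerSum r N φ (gridPoint j)) hδ fun μ hμ hμL => by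
      set c : ℕ → (Fin d → ℤ) → ℂ := fun n k =>
        (layerCoeff r n k : ℂ) * ∑ j, μ j * trigChar k (gridPoint j) with hc
      have hcv : ∀ n k, ∑ j, μ j * (((σ n * layerCoeff r n k : ℝ) : ℂ) * trigChar k (gridPoint j)) =
          (σ n : ℂ) * c n k := fun n k => by
        simp only [hc, Finset.mul_sum]
        refine Finset.sum_congr rfl fun j _ => ?_
        push_cast
        ring
      have hk := hG μ hμ fun l => by
        have h1 := hμL (ev (g l)) ⟨g l, Submodule.subset_span ⟨l, rfl⟩, rfl⟩
        rw [← h1]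
        change _ = ∑ j, μ j * g l (gridPoint j)
        simp_rw [hgx, Finset.mul_sum]
        rw [Finset.sum_comm]
        exact Finset.sum_congr rfl fun j _ => Finset.sum_congr rfl fun i _ => by ring
      have h2 : ∑ n ∈ Finset.range N, σ n ^ 2 * ∑ k ∈ freqBox d N, ‖c n k‖ ^ 2 ≤
          51200 * R * (16 * d ^ 2 * (N + 1)) / m := by
        refine le_trans (le_of_eq ?_) (hk.trans ?_)
        · simp only [hcv, norm_mul, mul_pow, Complex.norm_real, Real.norm_eq_abs, sq_abs]
          rw [hsumI fun i => σ i.1 ^ 2 * ‖c i.1 i.2‖ ^ 2]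
          simp_rw [Finset.mul_sum]
        · have := log_card_grid_le hd N
          gcongr
      have h3 := hφ c (fun n hn => mean_norm_sum_layerCoeff_le hd hr hr1 hn gridPoint μ hμ) h2
      refine le_trans (le_of_eq ?_) h3
      congr 1
      simp only [layerSum, hc, Finset.mul_sum, Finset.sum_mul]
      rw [Finset.sum_comm]
      refine Finset.sum_congr rfl fun n _ => ?_
      rw [Finset.sum_comm]
      exact Finset.sum_congr rfl fun k _ => Finset.sum_congr rfl fun j _ => by ring
  obtain ⟨h, hh, rfl⟩ := hu
  refine ⟨h, hh, fun x => ?_⟩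
  obtain ⟨b, hb⟩ := hrange hh
  have hdiff : ∀ y, layerSum r N φ y - h y = ∑ k ∈ freqBox d N,
      (∑ n ∈ Finset.range N, (layerCoeff r n k : ℂ) * fCoeff φ k - b k) * trigChar k y := fun y => by
    rw [layerSum_eq, ← hb, trigPolyMap_apply, ← Finset.sum_sub_distrib]
    exact Finset.sum_congr rfl fun k _ => by ring
  rw [hdiff]
  refine norm_trigPoly_le_of_grid hd N _ (fun j => ?_) x
  rw [← hdiff]
  exact huF j

theorem exists_sum_rpow_dist_le {ε : ℝ} (hε : 0 < ε) : ∃ K : ℝ, 0 < K ∧ ∀ (x : ℝ) (N : ℕ),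
    ∑ n ∈ Finset.range N, (2 : ℝ) ^ (-(ε * |(n : ℝ) - x|)) ≤ K := by
  have hq : (2 : ℝ) ^ (-ε) < 1 := Real.rpow_lt_one_of_one_lt_of_neg (by norm_num) (by linarith)
  have hgeo := summable_geometric_of_lt_one (by positivity) hq
  have hnat : ∀ n : ℕ, (2 : ℝ) ^ (-(ε * |(n : ℝ)|)) = (2 ^ (-ε)) ^ n := fun n => by
    rw [← Real.rpow_natCast, ← Real.rpow_mul (by norm_num), abs_of_nonneg (Nat.cast_nonneg n)]
    congr 1; ring
  have hs : Summable fun z : ℤ => (2 : ℝ) ^ (-(ε * |(z : ℝ)|)) := by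
    refine Summable.of_nat_of_neg ?_ ?_
    · simpa only [Int.cast_natCast, hnat] using hgeo
    · simpa only [Int.cast_neg, Int.cast_natCast, abs_neg, hnat] using hgeo
  have hpos : 0 < ∑' z : ℤ, (2 : ℝ) ^ (-(ε * |(z : ℝ)|)) :=
    hs.tsum_pos (fun _ => by positivity) 0 (by positivity)
  refine ⟨2 ^ ε * ∑' z : ℤ, (2 : ℝ) ^ (-(ε * |(z : ℝ)|)), by positivity, fun x N => ?_⟩
  have hinj : Function.Injective fun n : ℕ => (n : ℤ) - ⌊x⌋ := fun a b h => by
    have : (a : ℤ) - ⌊x⌋ = b - ⌊x⌋ := h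
    omega
  calc ∑ n ∈ Finset.range N, (2 : ℝ) ^ (-(ε * |(n : ℝ) - x|))
      ≤ ∑ n ∈ Finset.range N, 2 ^ ε * (2 : ℝ) ^ (-(ε * |(((n : ℤ) - ⌊x⌋ : ℤ) : ℝ)|)) := by
        refine Finset.sum_le_sum fun n _ => ?_
        rw [← Real.rpow_add (by norm_num)]
        refine Real.rpow_le_rpow_of_exponent_le (by norm_num) ?_
        have h1 : |(((n : ℤ) - ⌊x⌋ : ℤ) : ℝ)| ≤ |(n : ℝ) - x| + 1 := by
          push_cast
          have h2 : |x - ⌊x⌋| ≤ 1 := by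
            rw [abs_of_nonneg (by linarith [Int.floor_le x])]
            linarith [Int.lt_floor_add_one x]
          calc |(n : ℝ) - ⌊x⌋| = |((n : ℝ) - x) + (x - ⌊x⌋)| := by congr 1; ring
            _ ≤ _ := (abs_add_le _ _).trans (by linarith)
        nlinarith
    _ = 2 ^ ε * ∑ n ∈ Finset.range N, (2 : ℝ) ^ (-(ε * |(((n : ℤ) - ⌊x⌋ : ℤ) : ℝ)|)) := by
        rw [Finset.mul_sum]
    _ ≤ _ := by
        gcongr
        have h3 := hs.comp_injective hinj
        have hp : ∀ z : ℤ, 0 ≤ (2 : ℝ) ^ (-(ε * |(z : ℝ)|)) := fun z => by positivity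
        exact (h3.sum_le_tsum (Finset.range N) fun n _ => hp _).trans
          (tsum_comp_le_tsum_of_inj hs hp hinj)

theorem norm_sum_mul_fCoeff_le_of_layer {d : ℕ} {p r ε y a b : ℝ} (hp : 2 < p) (hε : 0 ≤ ε)
    (h1 : 2 * ε ≤ 1 / 2 - r) (h2 : 2 * ε ≤ r - 1 / p) (ha : 0 ≤ a) (hb : 0 ≤ b)
    (φ : Lp ℂ (ENNReal.ofReal p) (volume : Measure (Torus d))) (hφ : ‖φ‖ ≤ 2)
    (S : Finset (Fin d → ℤ)) (c : (Fin d → ℤ) → ℂ)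
    (hmean : ((2 * π) ^ d)⁻¹ * ∫ x : Torus d, ‖∑ k ∈ S, c k * conj (trigChar k x)‖ ≤
      a * 2 ^ (-(r * y)))
    (hnorm : √(∑ k ∈ S, ‖c k‖ ^ 2) ≤ b * 2 ^ ((1 / 2 - r) * y + ε * |y|)) :
    ‖∑ k ∈ S, c k * fCoeff φ k‖ ≤ (a + (1 + 2 ^ (p / 2)) * b) * 2 ^ (-(ε * |y|)) := by
  have hP : (0 : ℝ) < 2 ^ (p / 2) := by positivity
  set T : ℝ := 2 ^ (-(ε * |y|)) with hT
  have hT0 : 0 < T := by positivity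
  rcases le_total y 0 with hy | hy
  · have h := norm_sum_mul_fCoeff_le hp φ hφ S c (t := 1) one_pos
    rw [Real.one_rpow, mul_one, one_mul] at h
    have h3 : √(∑ k ∈ S, ‖c k‖ ^ 2) ≤ b * T := by
      refine hnorm.trans ?_
      rw [hT]
      gcongr
      · norm_num
      · rw [abs_of_nonpos hy]
        nlinarith
    have h4 := mean_norm_le_sqrt S c
    nlinarith [mul_nonneg ha hT0.le]
  · have h := norm_sum_mul_fCoeff_le hp φ hφ S c (t := 2 ^ (1 / p * y)) (by positivity)
    rw [abs_of_nonneg hy] at hnorm hT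
    have h3 : (2 : ℝ) ^ (1 / p * y) * (a * 2 ^ (-(r * y))) ≤ a * T := by
      rw [mul_left_comm, ← Real.rpow_add (by norm_num), hT]
      gcongr
      · norm_num
      · nlinarith
    have h4 : 2 ^ (p / 2) * ((2 : ℝ) ^ (1 / p * y)) ^ (1 - p / 2) *
        (b * 2 ^ ((1 / 2 - r) * y + ε * y)) ≤ 2 ^ (p / 2) * (b * T) := by
      rw [← Real.rpow_mul (by norm_num), mul_assoc, mul_left_comm _ b, ← Real.rpow_add (by norm_num),
        hT]
      gcongr
      · norm_num
      · have : 1 / p * y * (1 - p / 2) = 1 / p * y - y / 2 := by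
          field_simp
        rw [this]
        nlinarith
    calc _ ≤ _ := h
      _ ≤ (2 : ℝ) ^ (1 / p * y) * (a * 2 ^ (-(r * y))) +
          2 ^ (p / 2) * ((2 : ℝ) ^ (1 / p * y)) ^ (1 - p / 2) *
            (b * 2 ^ ((1 / 2 - r) * y + ε * y)) := by gcongr
      _ ≤ a * T + 2 ^ (p / 2) * (b * T) := add_le_add h3 h4
      _ ≤ _ := by nlinarith [mul_nonneg hb hT0.le]

theorem layer_scale_identities {d : ℕ} (hd : 1 ≤ d) {r m t X E : ℝ} (hm : 0 < m) (ht : 0 < t)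
    (hX : X = m * t ^ ((d : ℝ) - 2)) (hE : E = m ^ (-r) * t ^ (((d : ℝ) - 1) * (1 - r) + r)) :
    t ^ (d - 1) * X ^ (-r) = E ∧ t ^ d * X ^ (1 - 2 * r) / m = E ^ 2 := by
  have h1 : t ^ (d - 1) = t ^ ((d : ℝ) - 1) := by
    rw [← Real.rpow_natCast]; push_cast [hd]; rfl
  have hXr : ∀ a : ℝ, X ^ a = m ^ a * t ^ (((d : ℝ) - 2) * a) := fun a => by
    rw [hX, Real.mul_rpow hm.le (by positivity), ← Real.rpow_mul ht.le]
  constructor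
  · rw [h1, hXr, hE, mul_left_comm, ← Real.rpow_add ht]
    congr 2; ring
  · have h2 : t ^ d = t ^ (d : ℝ) := (Real.rpow_natCast t d).symm
    have h3 : m ^ (1 - 2 * r) / m = m ^ (-r) * m ^ (-r) := by
      rw [← Real.rpow_add hm, div_eq_iff hm.ne']
      nth_rewrite 3 [← Real.rpow_one m]
      rw [← Real.rpow_add hm]
      congr 1; ring
    rw [h2, hXr, hE, mul_left_comm, mul_div_right_comm, h3, mul_pow, pow_two, pow_two,
      ← Real.rpow_add ht, ← Real.rpow_add ht]
    congr 2; ring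

/-- Approximation of truncated layer expansions, uniformly over the unit ball, from a space of
dimension less than `m`. -/
theorem exists_submodule_layerSum_approx {d : ℕ} (hd : 1 ≤ d) {p r : ℝ} (hp : 2 < p)
    (hrp : 1 / p < r) (hr : r < 1 / 2) {K : ℝ} (hK : 0 < K) :
    ∃ C : ℝ, 0 < C ∧ ∀ m N : ℕ, 2 ≤ m → (N : ℝ) + 1 ≤ K * Real.log m →
      ∃ L : Submodule ℂ C(Torus d, ℂ), FiniteDimensional ℂ L ∧ Module.finrank ℂ L < m ∧
        ∀ φ : Lp ℂ (ENNReal.ofReal p) (volume : Measure (Torus d)), ‖φ‖ ≤ 2 →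
          ∃ h ∈ L, ∀ x, ‖layerSum r N φ x - h x‖ ≤
            C * ((m : ℝ) ^ (-r) * Real.log m ^ (((d : ℝ) - 1) * (1 - r) + r)) := by
  have hr0 : 0 < r := lt_trans (by positivity) hrp
  have hdpos : (0 : ℝ) < d := by exact_mod_cast hd
  set ε := min (1 / 2 - r) (r - 1 / p) / 2 with hε
  have hε0 : 0 < ε := by
    have : 0 < min (1 / 2 - r) (r - 1 / p) := lt_min (by linarith) (by linarith)
    rw [hε]; linarith
  have hε1 : 2 * ε ≤ 1 / 2 - r := by
    have := min_le_left (1 / 2 - r) (r - 1 / p)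
    rw [hε]; linarith
  have hε2 : 2 * ε ≤ r - 1 / p := by
    have := min_le_right (1 / 2 - r) (r - 1 / p)
    rw [hε]; linarith
  obtain ⟨A, hA, hgA⟩ := exists_sum_rpow_dist_le hε0
  obtain ⟨B, hB, hgB⟩ := exists_sum_rpow_dist_le (ε := 2 * ε) (by linarith)
  set D : ℝ := 51200 * (512 ^ d * K ^ (d - 1) * B) * (16 * d ^ 2 * K) * 2 with hD
  have hD0 : 0 < D := by positivity
  set P : ℝ := 4 ^ d * K ^ (d - 1) + (1 + 2 ^ (p / 2)) * √D with hPdef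
  have hP0 : 0 < P := by positivity
  refine ⟨4 * (P * A), by positivity, fun m N hm hN => ?_⟩
  have hm0 : (0 : ℝ) < m := by positivity
  have hm2 : (2 : ℝ) ≤ m := by exact_mod_cast hm
  set t := Real.log m with ht
  have ht0 : 0 < t := Real.log_pos (by linarith)
  set X : ℝ := m * t ^ ((d : ℝ) - 2) with hX
  have hX0 : 0 < X := by positivity
  set E : ℝ := (m : ℝ) ^ (-r) * t ^ (((d : ℝ) - 1) * (1 - r) + r) with hE
  have hE0 : 0 < E := by positivity
  obtain ⟨hid1, hid2⟩ := layer_scale_identities (r := r) hd hm0 ht0 hX hE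
  set x := Real.logb 2 X with hx
  have h2x : (2 : ℝ) ^ x = X := Real.rpow_logb (by norm_num) (by norm_num) hX0
  set σ : ℕ → ℝ := fun n => 2 ^ (-((1 / 2 - r) * ((n : ℝ) - x) + ε * |(n : ℝ) - x|)) with hσdef
  have hσpos : ∀ n, 0 < σ n := fun n => by positivity
  set R : ℝ := 512 ^ d * (K * t) ^ (d - 1) * X ^ (1 - 2 * r) * B with hR
  have hR0 : 0 < R := by positivity
  have hn1 : ∀ n ∈ Finset.range N, (n : ℝ) + 1 ≤ K * t := fun n hn => by
    have : (n : ℝ) + 1 ≤ N := by exact_mod_cast Finset.mem_range.1 hn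
    linarith
  have hσR : ∑ n ∈ Finset.range N, σ n ^ 2 * ∑ k ∈ freqBox d N, layerCoeff r n k ^ 2 ≤ R := by
    calc _ ≤ ∑ n ∈ Finset.range N, 512 ^ d * (K * t) ^ (d - 1) * X ^ (1 - 2 * r) *
          (2 : ℝ) ^ (-(2 * ε * |(n : ℝ) - x|)) := by
          refine Finset.sum_le_sum fun n hn => ?_
          have e : σ n ^ 2 * 2 ^ ((1 - 2 * r) * n) =
              X ^ (1 - 2 * r) * (2 : ℝ) ^ (-(2 * ε * |(n : ℝ) - x|)) := by
            rw [← h2x, ← Real.rpow_mul (by norm_num), ← Real.rpow_add (by norm_num), hσdef]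
            simp only
            rw [← Real.rpow_natCast, ← Real.rpow_mul (by norm_num), ← Real.rpow_add (by norm_num)]
            congr 1
            push_cast
            ring
          calc σ n ^ 2 * ∑ k ∈ freqBox d N, layerCoeff r n k ^ 2
              ≤ σ n ^ 2 * (512 ^ d * ((n : ℝ) + 1) ^ (d - 1) * 2 ^ ((1 - 2 * r) * n)) := by
                gcongr
                exact sum_layerCoeff_sq_le hd hr0.le (by linarith) n N
            _ ≤ σ n ^ 2 * (512 ^ d * (K * t) ^ (d - 1) * 2 ^ ((1 - 2 * r) * n)) := by
                gcongr
                exact hn1 n hn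
            _ = 512 ^ d * (K * t) ^ (d - 1) * (σ n ^ 2 * 2 ^ ((1 - 2 * r) * n)) := by ring
            _ = _ := by rw [e]; ring
      _ ≤ R := by
          rw [← Finset.mul_sum, hR]
          gcongr
          exact hgB x N
  have hPA : P * A * E < 2 * (P * A * E) := by
    have : 0 < P * A * E := by positivity
    linarith
  have hm1 : 1 ≤ m - 1 := by omega
  obtain ⟨L, hL1, hL2, hL3⟩ := exists_submodule_forall_layerSum_sub_le hd hr0.le (by linarith) hm1 σ
    hR0 hσR hPA
  refine ⟨L, hL1, by omega, fun φ hφ => ?_⟩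
  obtain ⟨h, hh, hhx⟩ := hL3 φ fun c hmean hc => by
    have hQ : 51200 * R * (16 * (d : ℝ) ^ 2 * (N + 1)) / (m - 1 : ℕ) ≤ D * E ^ 2 := by
      have hmm : (m : ℝ) / 2 ≤ (m - 1 : ℕ) := by
        push_cast [show 1 ≤ m by omega]
        linarith
      calc _ ≤ 51200 * R * (16 * (d : ℝ) ^ 2 * (K * t)) / (m / 2) := by gcongr
        _ = D * (t ^ d * X ^ (1 - 2 * r) / m) := by
            obtain ⟨e, rfl⟩ : ∃ e, d = e + 1 := ⟨d - 1, by omega⟩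
            rw [hD, hR, Nat.add_sub_cancel, mul_pow, pow_succ t]
            field_simp
        _ = _ := by rw [hid2]
    have hsq : √(D * E ^ 2) = √D * E := by
      rw [Real.sqrt_mul hD0.le, Real.sqrt_sq hE0.le]
    have hlayer : ∀ n ∈ Finset.range N, ‖∑ k ∈ freqBox d N, c n k * fCoeff φ k‖ ≤
        P * E * 2 ^ (-(ε * |(n : ℝ) - x|)) := fun n hn => by
      refine (norm_sum_mul_fCoeff_le_of_layer (a := 4 ^ d * K ^ (d - 1) * E) (b := √D * E)
        (y := (n : ℝ) - x) hp hε0.le hε1 hε2 (by positivity) (by positivity) φ hφ _ _ ?_ ?_).trans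
          (le_of_eq ?_)
      · refine (hmean n (Finset.mem_range.1 hn)).trans ?_
        have e : (2 : ℝ) ^ (-(r * n)) = X ^ (-r) * 2 ^ (-(r * ((n : ℝ) - x))) := by
          rw [← h2x, ← Real.rpow_mul (by norm_num), ← Real.rpow_add (by norm_num)]
          congr 1; ring
        calc _ ≤ 4 ^ d * (K * t) ^ (d - 1) * (2 : ℝ) ^ (-(r * n)) := by
              gcongr
              exact hn1 n hn
          _ = _ := by rw [e, ← hid1, mul_pow]; ring
      · have h1 : σ n ^ 2 * ∑ k ∈ freqBox d N, ‖c n k‖ ^ 2 ≤ D * E ^ 2 :=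
          (Finset.single_le_sum (f := fun n => σ n ^ 2 * ∑ k ∈ freqBox d N, ‖c n k‖ ^ 2)
            (fun _ _ => by positivity) hn).trans (hc.trans hQ)
        have h2 := Real.sqrt_le_sqrt h1
        rw [hsq, Real.sqrt_mul (sq_nonneg _), Real.sqrt_sq (hσpos n).le, ← le_div_iff₀' (hσpos n)] at h2
        refine h2.trans (le_of_eq ?_)
        rw [div_eq_mul_inv, hσdef]
        simp only
        rw [← Real.rpow_neg (by norm_num), neg_neg]
      · rw [hPdef]; ring
    calc _ ≤ ∑ n ∈ Finset.range N, P * E * 2 ^ (-(ε * |(n : ℝ) - x|)) := norm_sum_le_of_le _ hlayer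
      _ ≤ P * E * A := by
          rw [← Finset.mul_sum]
          gcongr
          exact hgA x N
      _ = _ := by ring
  refine ⟨h, hh, fun y => (hhx y).trans (le_of_eq ?_)⟩
  ring

theorem exists_WRel_norm_le_two {d : ℕ} {r : ℝ} {q : ℝ≥0∞} (a : WSpace d r q) (ha : ‖a‖ ≤ 1) :
    ∃ φ : Lp ℂ q (volume : Measure (Torus d)), WRel d r q a.1 φ ∧ ‖φ‖ ≤ 2 := by
  obtain ⟨φ₀, h₀⟩ := a.2
  set V : Set ℝ := {c : ℝ | ∃ φ : Lp ℂ q (volume : Measure (Torus d)),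
    WRel d r q a.1 φ ∧ ‖φ‖ = c} with hV
  have h1 : sInf V < 2 := lt_of_le_of_lt ha (by norm_num)
  have h2 : V.Nonempty := ⟨‖φ₀‖, φ₀, h₀, rfl⟩
  obtain ⟨_, ⟨φ, hφ, rfl⟩, hc⟩ := exists_lt_of_csInf_lt h2 h1
  exact ⟨φ, hφ, hc.le⟩

theorem dK_le_of_submodule {A B : Type*} [Norm A] [NormedAddCommGroup B] [NormedSpace ℂ B]
    (T : A → B) {m : ℕ} (L : Submodule ℂ B) (hL : FiniteDimensional ℂ L)
    (hLm : Module.finrank ℂ L < m) {δ : ℝ} (hδ : 0 ≤ δ)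
    (h : ∀ a : A, ‖a‖ ≤ 1 → ∃ b ∈ L, ‖T a - b‖ ≤ δ) : dK T m ≤ δ := by
  unfold dK
  refine (ciInf_le ⟨0, ?_⟩ ⟨L, hL, hLm⟩).trans (Real.iSup_le (fun a => ?_) hδ)
  · rintro _ ⟨L', rfl⟩
    exact Real.iSup_nonneg fun a => Real.iInf_nonneg fun b => norm_nonneg _
  · obtain ⟨b, hb, hab⟩ := h a.1 a.2
    refine (ciInf_le ⟨0, ?_⟩ (⟨b, hb⟩ : L)).trans hab
    rintro _ ⟨b', rfl⟩
    exact norm_nonneg _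

theorem norm_sub_toLp_le {d : ℕ} (f : Lp ℂ ∞ (volume : Measure (Torus d))) (h : C(Torus d, ℂ))
    {δ : ℝ} (hδ : 0 ≤ δ) (hfh : ∀ᵐ x, ‖f x - h x‖ ≤ δ) :
    ‖f - ContinuousMap.toLp ∞ (volume : Measure (Torus d)) ℂ h‖ ≤ δ := by
  have h1 : ∀ᵐ x, ‖(f - ContinuousMap.toLp ∞ (volume : Measure (Torus d)) ℂ h :
      Lp ℂ ∞ (volume : Measure (Torus d))) x‖ ≤ δ := by
    filter_upwards [hfh, Lp.coeFn_sub f (ContinuousMap.toLp ∞ (volume : Measure (Torus d)) ℂ h),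
      ContinuousMap.coeFn_toLp (p := ∞) (𝕜 := ℂ) (volume : Measure (Torus d)) h] with x hx hs ht
    rw [hs, Pi.sub_apply, ht]
    exact hx
  simpa using Lp.norm_le_of_ae_bound hδ h1

theorem stmt17 (d : ℕ) (hd : 1 ≤ d) (p r : ℝ) (hp : 2 < p)
    (hrp : 1 / p < r) (hr : r < 1 / 2) :
    ∃ C : ℝ, 0 < C ∧ ∀ m : ℕ, 2 ≤ m →
      dK (fun f : WSpace d r (ENNReal.ofReal p) =>
          (f.1 : Lp ℂ ∞ (volume : Measure (Torus d)))) m ≤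
        C * (m : ℝ) ^ (-r) * Real.log m ^ ((d - 1 : ℝ) * (1 - r) + r) := by
  have hr0 : 0 < r := lt_trans (by positivity) hrp
  have hd1 : (1 : ℝ) ≤ d := by exact_mod_cast hd
  obtain ⟨C₁, hC₁, htail⟩ := ae_norm_sub_sum_layerCoeff_le (d := d) hp hrp (by linarith)
  set κ := (r - 1 / p) / 2 with hκ
  have hκ0 : 0 < κ := by rw [hκ]; linarith
  have hlog2 : 1 / 2 < Real.log 2 := by linarith [Real.log_two_gt_d9]
  have hlog0 : 0 < Real.log 2 := by linarith
  set K := r / (κ * Real.log 2) with hK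
  have hK0 : 0 < K := by positivity
  obtain ⟨C₂, hC₂, happrox⟩ := exists_submodule_layerSum_approx hd hp hrp hr
    (K := K + 4) (by linarith)
  set β := ((d : ℝ) - 1) * (1 - r) + r with hβ
  have hβ0 : 0 < β := by
    have : 0 ≤ ((d : ℝ) - 1) * (1 - r) := mul_nonneg (by linarith) (by linarith)
    linarith
  refine ⟨C₁ * (Real.log 2 ^ β)⁻¹ + C₂, by positivity, fun m hm => ?_⟩
  have hm2 : (2 : ℝ) ≤ m := by exact_mod_cast hm
  have hm0 : (0 : ℝ) < m := by linarith
  have ht2 : Real.log 2 ≤ Real.log m := Real.log_le_log (by norm_num) hm2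
  set t := Real.log m with ht
  have ht0 : 0 < t := by linarith
  set N := ⌈K * t⌉₊ with hN
  have hN1 : K * t ≤ N := Nat.le_ceil _
  have hN2 : (N : ℝ) + 1 ≤ (K + 4) * t := by
    have := Nat.ceil_lt_add_one (a := K * t) (by positivity)
    rw [← hN] at this
    linarith
  obtain ⟨L, hL1, hL2, hL3⟩ := happrox m N hm hN2
  have htail' : (2 : ℝ) ^ (-(κ * N)) ≤ (Real.log 2 ^ β)⁻¹ * ((m : ℝ) ^ (-r) * t ^ β) := by
    have h1 : (2 : ℝ) ^ (-(κ * N)) ≤ (m : ℝ) ^ (-r) := by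
      rw [Real.rpow_def_of_pos two_pos, Real.rpow_def_of_pos hm0, ← ht]
      refine Real.exp_le_exp.2 ?_
      have h2 : K * t * (κ * Real.log 2) = r * t := by
        rw [hK]; field_simp
      have h3 : K * t * (κ * Real.log 2) ≤ N * (κ * Real.log 2) := by gcongr
      linarith
    have h4 : Real.log 2 ^ β ≤ t ^ β := by gcongr
    have h5 : (0 : ℝ) < Real.log 2 ^ β := by positivity
    rw [le_inv_mul_iff₀ h5, mul_comm]
    gcongr
  have hE0 : 0 ≤ (m : ℝ) ^ (-r) * t ^ β := by positivity
  have : FiniteDimensional ℂ L := hL1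
  refine dK_le_of_submodule _
    (L.map (ContinuousMap.toLp ∞ (volume : Measure (Torus d)) ℂ).toLinearMap)
    inferInstance ((Submodule.finrank_map_le _ _).trans_lt hL2) (by positivity) fun f hf => ?_
  obtain ⟨φ, hW, hφ⟩ := exists_WRel_norm_le_two f hf
  obtain ⟨h, hh, hhx⟩ := hL3 φ hφ
  refine ⟨_, ⟨h, hh, rfl⟩, norm_sub_toLp_le f.1 h (by positivity) ?_⟩
  filter_upwards [htail f.1 φ hW hφ N] with x hx
  calc ‖f.1 x - h x‖ = ‖(f.1 x - layerSum r N φ x) + (layerSum r N φ x - h x)‖ := by congr 1; ring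
    _ ≤ C₁ * 2 ^ (-(κ * N)) + C₂ * ((m : ℝ) ^ (-r) * t ^ β) :=
        (norm_add_le _ _).trans (add_le_add hx (hhx x))
    _ ≤ C₁ * ((Real.log 2 ^ β)⁻¹ * ((m : ℝ) ^ (-r) * t ^ β)) +
        C₂ * ((m : ℝ) ^ (-r) * t ^ β) := by gcongr
    _ = _ := by ring

end
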